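/- Let p_n denote the n-th prime and P_odd = {p_n : n odd}. There do not exist a positive integer q and residues a₁,…,a_r mod q such that the symmetric difference P_odd △ ∪_{j=1}^r P_{a_j,q} is finite. That is, P_odd cannot be realized, even up to finitely many exceptions, as a finite union of sets of primes in arithmetic progressions. -/

import Mathlib

/-- The set of rational primes congruent to `a` mod `q`. -/
def residueClassPrimes (q : ℕ) (a : ZMod q) : Set ℕ :=
  {p | p.Prime ∧ (p : ZMod q) = a}

/-- The number of elements of a set `P` of natural numbers that are `≤ x`. -/
noncomputable def natCount (P : Set ℕ) (x : ℝ) : ℕ :=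
  Set.ncard {p | p ∈ P ∧ (p : ℝ) ≤ x}

/-- The prime counting function `π(x)`. -/
noncomputable def primePi (x : ℝ) : ℕ := natCount {p | p.Prime} x

/-- `f = Ω(g)`: `limsup |f|/g > 0`, i.e. there are `c > 0` and arbitrarily large `x`
with `|f x| ≥ c * g x`. -/
def IsOmega (f g : ℝ → ℝ) : Prop :=
  ∃ c > (0:ℝ), ∀ X : ℝ, ∃ x ≥ X, |f x| ≥ c * g x

/-- `P_odd = {p_n : n odd}`, the set of every other prime (`Nat.nth Nat.Prime` is
0-indexed, so these are `Nat.nth Nat.Prime n` for `n` even). -/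
noncomputable def POdd : Set ℕ := {p | ∃ n : ℕ, Even n ∧ p = Nat.nth Nat.Prime n}

open Filter Topology Metric
open scoped ComplexConjugate

/-- An entire function factors as a power of `z - ρ` and an entire function not vanishing at `ρ`. -/
lemma exists_entire_factor {f : ℂ → ℂ} (hf : Differentiable ℂ f) {ρ : ℂ}
    (hρ : analyticOrderAt f ρ ≠ ⊤) :
    ∃ g : ℂ → ℂ, Differentiable ℂ g ∧ g ρ ≠ 0 ∧
      ∀ z, f z = (z - ρ) ^ analyticOrderNatAt f ρ * g z := by
  obtain ⟨g, hg, hgρ, hfg⟩ := (hf.analyticAt ρ).analyticOrderAt_eq_natCast.mp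
    (Nat.cast_analyticOrderNatAt hρ).symm
  set m := analyticOrderNatAt f ρ
  simp only [smul_eq_mul] at hfg
  refine ⟨Function.update (fun z ↦ f z / (z - ρ) ^ m) ρ (g ρ), fun z ↦ ?_, by simpa, fun z ↦ ?_⟩
  · rcases eq_or_ne z ρ with rfl | hz
    · refine hg.differentiableAt.congr_of_eventuallyEq ?_
      filter_upwards [hfg] with w hw
      rcases eq_or_ne w z with rfl | hwz
      · simp
      · rw [Function.update_of_ne hwz, hw, mul_div_cancel_left₀]
        exact pow_ne_zero _ (sub_ne_zero.mpr hwz)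
    · have : DifferentiableAt ℂ (fun z ↦ f z / (z - ρ) ^ m) z := by
        have := pow_ne_zero m (sub_ne_zero.mpr hz)
        have := hf z
        fun_prop (disch := assumption)
      refine this.congr_of_eventuallyEq ?_
      filter_upwards [isOpen_ne.mem_nhds hz] with w hw
      rw [Function.update_of_ne hw]
  · rcases eq_or_ne z ρ with rfl | hz
    · simpa using hfg.self_of_nhds
    · rw [Function.update_of_ne hz, mul_div_cancel₀]
      exact pow_ne_zero _ (sub_ne_zero.mpr hz)

lemma analyticOrderAt_ne_top_of_entire {f : ℂ → ℂ} (hf : Differentiable ℂ f) {c : ℂ}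
    (hc : f c ≠ 0) (ρ : ℂ) : analyticOrderAt f ρ ≠ ⊤ := by
  refine AnalyticOnNhd.analyticOrderAt_ne_top_of_isPreconnected (U := Set.univ) (x := c)
    (fun z _ ↦ hf.analyticAt z) isPreconnected_univ trivial trivial ?_
  rw [(hf.analyticAt c).analyticOrderAt_eq_zero.mpr hc]
  simp

/-- The zeros in a finite set can be divided out of an entire function. -/
lemma exists_entire_factor_finset {f : ℂ → ℂ} (hf : Differentiable ℂ f) {c : ℂ} (hc : f c ≠ 0)
    (Z : Finset ℂ) :
    ∃ h : ℂ → ℂ, Differentiable ℂ h ∧ (∀ ρ ∈ Z, h ρ ≠ 0) ∧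
      ∀ z, f z = (∏ ρ ∈ Z, (z - ρ) ^ analyticOrderNatAt f ρ) * h z := by
  classical
  induction Z using Finset.induction_on with
  | empty => exact ⟨f, hf, by simp, by simp⟩
  | insert ρ Z hρ ih =>
    obtain ⟨h, hh, hhZ, hfh⟩ := ih
    have hhc : h c ≠ 0 := fun h0 ↦ hc (by rw [hfh, h0, mul_zero])
    have hP : Differentiable ℂ (fun z ↦ ∏ ρ ∈ Z, (z - ρ) ^ analyticOrderNatAt f ρ) := by fun_prop
    have hPρ : ∏ ρ' ∈ Z, (ρ - ρ') ^ analyticOrderNatAt f ρ' ≠ 0 := by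
      refine Finset.prod_ne_zero_iff.mpr fun a ha ↦ pow_ne_zero _ (sub_ne_zero.mpr ?_)
      rintro rfl
      exact hρ ha
    have hord : analyticOrderNatAt h ρ = analyticOrderNatAt f ρ := by
      have : f = (fun z ↦ ∏ ρ ∈ Z, (z - ρ) ^ analyticOrderNatAt f ρ) * h := funext hfh
      conv_rhs => rw [analyticOrderNatAt, this,
        analyticOrderAt_mul (hP.analyticAt ρ) (hh.analyticAt ρ),
        (hP.analyticAt ρ).analyticOrderAt_eq_zero.mpr hPρ, zero_add]
      rfl
    obtain ⟨g, hg, hgρ, hhg⟩ := exists_entire_factor hh (analyticOrderAt_ne_top_of_entire hh hhc ρ)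
    refine ⟨g, hg, fun a ha ↦ ?_, fun z ↦ ?_⟩
    · rcases Finset.mem_insert.mp ha with rfl | ha
      · exact hgρ
      · exact fun h0 ↦ hhZ a ha (by rw [hhg, h0, mul_zero])
    · rw [Finset.prod_insert hρ, hfh, hhg, hord]
      ring

/-- A non-vanishing function on a ball whose quotient by its central value is at most `exp M` has
logarithmic derivative `O(M)`. -/
lemma norm_logDeriv_le_of_ne_zero {h : ℂ → ℂ} (hh : Differentiable ℂ h) {c : ℂ} {R M : ℝ}
    (hR : 1 ≤ R) (hM : 0 < M) (hne : ∀ z ∈ ball c R, h z ≠ 0)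
    (hb : ∀ z ∈ ball c R, ‖h z‖ ≤ Real.exp M * ‖h c‖) {z : ℂ} (hz : z ∈ ball c (R / 4)) :
    ‖logDeriv h z‖ ≤ 8 * M := by
  have hcb : c ∈ ball c R := mem_ball_self (by linarith)
  have hld : DifferentiableOn ℂ (logDeriv h) (ball c R) := by
    intro w hw
    exact ((hh.deriv w).div (hh w) (hne w hw)).differentiableWithinAt
  obtain ⟨G, hGc, hG⟩ := hld.isExactOn_ball.with_val_at c 0
  have hexp : ∀ w ∈ ball c R, h w = h c * Complex.exp (G w) := by
    have hd : ∀ w ∈ ball c R, HasDerivAt (fun w ↦ h w * Complex.exp (-G w)) 0 w := by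
      intro w hw
      have := (hh w).hasDerivAt.mul ((hG w hw).neg.cexp)
      refine this.congr_deriv ?_
      rw [logDeriv_apply]
      field_simp [hne w hw]
      ring
    intro w hw
    have := (convex_ball c R).is_const_of_fderivWithin_eq_zero (𝕜 := ℂ)
      (f := fun w ↦ h w * Complex.exp (-G w))
      (fun w hw ↦ (hd w hw).differentiableAt.differentiableWithinAt)
      (fun w hw ↦ by
        rw [fderivWithin_of_isOpen isOpen_ball hw]
        ext
        simpa using (hd w hw).deriv) hw hcb
    simp only [hGc, neg_zero, Complex.exp_zero, mul_one] at this
    rw [← this, mul_assoc, ← Complex.exp_add]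
    simp
  have hmaps : Set.MapsTo (fun w ↦ G (c + w)) (ball 0 R) {z | z.re ≤ M} := by
    intro w hw
    have hw' : c + w ∈ ball c R := by simpa [dist_eq_norm] using hw
    have h1 := hb _ hw'
    rw [hexp _ hw', norm_mul, Complex.norm_exp, mul_comm] at h1
    have h2 := le_of_mul_le_mul_right h1 (norm_pos_iff.mpr (hne c hcb))
    simpa using h2
  have hGd : DifferentiableOn ℂ (fun w ↦ G (c + w)) (ball 0 R) := by
    intro w hw
    have hw' : c + w ∈ ball c R := by simpa [dist_eq_norm] using hw
    exact ((hG _ hw').comp_const_add c w).differentiableAt.differentiableWithinAt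
  have hbd : ∀ w ∈ ball c R, ‖w - c‖ ≤ R / 2 → ‖G w‖ ≤ 2 * M := by
    intro w hw hw2
    have := Complex.borelCaratheodory_zero (z := w - c) hM hGd hmaps (by linarith)
      (by simpa [dist_eq_norm] using hw) (by simpa using hGc)
    simp only [add_sub_cancel] at this
    refine this.trans ?_
    rw [div_le_iff₀ (by linarith)]
    nlinarith
  have hzR : z ∈ ball c R := ball_subset_ball (by linarith) hz
  have hsub : closedBall z (R / 4) ⊆ ball c R := by
    refine (closedBall_subset_ball' ?_)
    rw [mem_ball] at hz
    linarith
  rw [← (hG z hzR).deriv]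
  refine (Complex.norm_deriv_le_of_forall_mem_sphere_norm_le (R := R / 4) (C := 2 * M)
    (by linarith) ?_ fun w hw ↦ ?_).trans ?_
  · refine DifferentiableOn.diffContOnCl fun w hw ↦ ?_
    rw [closure_ball _ (by linarith)] at hw
    exact (hG w (hsub hw)).differentiableAt.differentiableWithinAt
  · refine hbd w (hsub (sphere_subset_closedBall hw)) ?_
    rw [mem_sphere, dist_eq_norm] at hw
    rw [mem_ball, dist_eq_norm] at hz
    calc ‖w - c‖ ≤ ‖w - z‖ + ‖z - c‖ := norm_sub_le_norm_sub_add_norm_sub ..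
      _ ≤ R / 2 := by linarith
  · rw [div_le_iff₀ (by linarith)]
    nlinarith

/-- Local partial fraction expansion of the logarithmic derivative of an entire function of order
at most two. -/
lemma exists_logDeriv_eq_sum_add {f : ℂ → ℂ} (hf : Differentiable ℂ f) {c : ℂ} (hc : f c ≠ 0)
    {A : ℝ} (hA : ∀ z, ‖f z‖ ≤ Real.exp (A * (1 + ‖z‖) ^ 2)) :
    ∃ K : ℝ, ∀ R : ℝ, 1 ≤ R → ∀ Z : Finset ℂ, (∀ z ∈ closedBall c R, f z = 0 → z ∈ Z) →
      (∀ z ∈ Z, z ∈ closedBall c R) →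
      ∃ h : ℂ → ℂ, Differentiable ℂ h ∧ (∀ z ∈ closedBall c R, h z ≠ 0) ∧
        (∀ z, f z ≠ 0 →
          logDeriv f z = ∑ ρ ∈ Z, analyticOrderNatAt f ρ / (z - ρ) + logDeriv h z) ∧
        ∀ z ∈ ball c (R / 4), ‖logDeriv h z‖ ≤ K * R ^ 2 := by
  have hfc : 0 < ‖f c‖ := norm_pos_iff.mpr hc
  set B : ℝ := |A| * (3 + ‖c‖) ^ 2 + |Real.log ‖f c‖| + 1 with hB
  refine ⟨8 * B, fun R hR Z hZ hZR ↦ ?_⟩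
  obtain ⟨h, hh, hhZ, hfh⟩ := exists_entire_factor_finset hf hc Z
  have hne : ∀ z ∈ closedBall c R, h z ≠ 0 := by
    intro z hz h0
    exact hhZ z (hZ z hz (by rw [hfh, h0, mul_zero])) h0
  refine ⟨h, hh, hne, fun z hz ↦ ?_, fun z hz ↦ ?_⟩
  · have hhz : h z ≠ 0 := fun h0 ↦ hz (by rw [hfh, h0, mul_zero])
    have hPz : ∏ ρ ∈ Z, (z - ρ) ^ analyticOrderNatAt f ρ ≠ 0 :=
      fun h0 ↦ hz (by rw [hfh, h0, zero_mul])
    have hfe : f = fun z ↦ (∏ ρ ∈ Z, (z - ρ) ^ analyticOrderNatAt f ρ) * h z := funext hfh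
    conv_lhs => rw [hfe]
    rw [logDeriv_mul z hPz hhz (by fun_prop) (hh z),
      logDeriv_prod (fun i hi ↦ Finset.prod_ne_zero_iff.mp hPz i hi) (by fun_prop)]
    congr 1
    refine Finset.sum_congr rfl fun ρ _ ↦ ?_
    rw [logDeriv_fun_pow (by fun_prop), logDeriv_apply]
    simp [div_eq_mul_inv]
  · have hBR : 0 < B * R ^ 2 := by positivity
    have := norm_logDeriv_le_of_ne_zero hh hR hBR (fun w hw ↦ hne w (ball_subset_closedBall hw))
      (fun w hw ↦ ?_) hz
    · linarith
    refine Complex.norm_le_of_forall_mem_frontier_norm_le (U := ball c (2 * R)) isBounded_ball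
      hh.diffContOnCl (fun v hv ↦ ?_) (subset_closure (ball_subset_ball (by linarith) hw))
    rw [frontier_ball _ (by linarith), mem_sphere, dist_eq_norm] at hv
    have hprod : ‖∏ ρ ∈ Z, (c - ρ) ^ analyticOrderNatAt f ρ‖ ≤
        ‖∏ ρ ∈ Z, (v - ρ) ^ analyticOrderNatAt f ρ‖ := by
      rw [norm_prod, norm_prod]
      refine Finset.prod_le_prod (fun _ _ ↦ norm_nonneg _) fun ρ hρ ↦ ?_
      rw [norm_pow, norm_pow]
      refine pow_le_pow_left₀ (norm_nonneg _) ?_ _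
      have h1 := hZR ρ hρ
      rw [mem_closedBall, dist_eq_norm, norm_sub_rev] at h1
      have h2 : ‖v - c‖ ≤ ‖v - ρ‖ + ‖c - ρ‖ := by
        simpa [norm_sub_rev] using norm_sub_le_norm_sub_add_norm_sub v ρ c
      linarith
    have hv1 : 1 + ‖v‖ ≤ (3 + ‖c‖) * R := by
      have : ‖v‖ ≤ ‖v - c‖ + ‖c‖ := by simpa using norm_add_le (v - c) c
      nlinarith [norm_nonneg c]
    have hexp : A * (1 + ‖v‖) ^ 2 - Real.log ‖f c‖ ≤ B * R ^ 2 := by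
      have h1 : A * (1 + ‖v‖) ^ 2 ≤ |A| * ((3 + ‖c‖) * R) ^ 2 :=
        mul_le_mul (le_abs_self A) (pow_le_pow_left₀ (by positivity) hv1 2) (by positivity)
          (abs_nonneg A)
      have h2 := neg_le_abs (Real.log ‖f c‖)
      have h3 : 1 ≤ R ^ 2 := one_le_pow₀ hR
      rw [hB]
      nlinarith [abs_nonneg (Real.log ‖f c‖)]
    have hPv : 0 < ‖∏ ρ ∈ Z, (v - ρ) ^ analyticOrderNatAt f ρ‖ := by
      refine lt_of_lt_of_le (norm_pos_iff.mpr fun h0 ↦ hc ?_) hprod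
      rw [hfh, h0, zero_mul]
    have h1 : ‖f v‖ ≤ Real.exp (B * R ^ 2) * ‖f c‖ := by
      refine (hA v).trans ?_
      conv_rhs => rw [← Real.exp_log hfc, ← Real.exp_add]
      exact Real.exp_le_exp.mpr (by linarith)
    rw [hfh v, hfh c, norm_mul, norm_mul] at h1
    refine le_of_mul_le_mul_left ?_ hPv
    calc _ ≤ _ := h1
      _ ≤ Real.exp (B * R ^ 2) * (‖∏ ρ ∈ Z, (v - ρ) ^ analyticOrderNatAt f ρ‖ * ‖h c‖) := by gcongr
      _ = _ := by ring

lemma eventually_ne_zero_of_entire {f : ℂ → ℂ} (hf : Differentiable ℂ f) {c : ℂ}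
    (hc : f c ≠ 0) (z : ℂ) : ∀ᶠ w in 𝓝[≠] z, f w ≠ 0 := by
  rcases (hf.analyticAt z).eventually_eq_zero_or_eventually_ne_zero with h | h
  · exact absurd (analyticOrderAt_eq_top.mpr h) (analyticOrderAt_ne_top_of_entire hf hc z)
  · exact h

lemma finite_zeros_closedBall {f : ℂ → ℂ} (hf : Differentiable ℂ f) {c : ℂ}
    (hc : f c ≠ 0) (x : ℂ) (R : ℝ) : {z | z ∈ closedBall x R ∧ f z = 0}.Finite := by
  have h : f ⁻¹' {0}ᶜ ∈ codiscrete ℂ :=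
    AnalyticOnNhd.preimage_zero_mem_codiscrete (fun z _ ↦ hf.analyticAt z) hc
  have := (isCompact_closedBall x R).finite_sdiff_of_mem_codiscreteWithin
    (codiscreteWithin_mono (Set.subset_univ _) h)
  refine this.subset fun z hz ↦ ⟨hz.1, by simp [hz.2]⟩

/-- An entire function growing at most quadratically is a polynomial. -/
lemma exists_polynomial_of_growth {f : ℂ → ℂ} (hf : Differentiable ℂ f) {c : ℂ} {K R₀ : ℝ}
    (hK : ∀ R : ℝ, R₀ ≤ R → ∀ z ∈ ball c (R / 4), ‖f z‖ ≤ K * R ^ 2) :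
    ∃ P : Polynomial ℂ, ∀ z, f z = P.eval z := by
  have h0 : ∀ n, 3 ≤ n → iteratedDeriv n f c = 0 := by
    intro n hn
    obtain ⟨k, rfl⟩ := Nat.exists_eq_add_of_le hn
    have hbd : ∀ᶠ R : ℝ in atTop, ‖iteratedDeriv (3 + k) f c‖ ≤
        ((3 + k).factorial * (|K| * 5 ^ 2)) * R⁻¹ := by
      filter_upwards [eventually_ge_atTop R₀, eventually_ge_atTop (1 : ℝ)] with R hR hR1
      have := Complex.norm_iteratedDeriv_le_of_forall_mem_sphere_norm_le (c := c) (R := R)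
        (C := |K| * (5 * R) ^ 2) (3 + k) (by linarith) hf.diffContOnCl fun z hz ↦ by
          have h1 := hK (5 * R) (by linarith) z (by
            rw [mem_sphere] at hz; rw [mem_ball]; linarith)
          refine h1.trans ?_
          gcongr
          exact le_abs_self K
      refine this.trans ?_
      rw [mul_pow, pow_add, div_le_iff₀ (by positivity)]
      have : (1 : ℝ) ≤ R ^ k := one_le_pow₀ hR1
      calc _ = ((3 + k).factorial * (|K| * 5 ^ 2)) * R ^ 2 * 1 := by ring
        _ ≤ ((3 + k).factorial * (|K| * 5 ^ 2)) * R ^ 2 * R ^ k := by gcongr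
        _ = _ := by field_simp
    have hlim : Tendsto (fun R : ℝ ↦ ((3 + k).factorial * (|K| * 5 ^ 2)) * R⁻¹) atTop (𝓝 0) := by
      simpa using tendsto_inv_atTop_zero.const_mul (((3 + k).factorial * (|K| * 5 ^ 2)) : ℝ)
    exact norm_le_zero_iff.mp (ge_of_tendsto hlim hbd)
  refine ⟨∑ n ∈ Finset.range 3, Polynomial.C ((n.factorial : ℂ)⁻¹ * iteratedDeriv n f c) *
    (Polynomial.X - Polynomial.C c) ^ n, fun z ↦ ?_⟩
  rw [← Complex.taylorSeries_eq_of_entire' c z hf, tsum_eq_sum (s := Finset.range 3)]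
  · simp [Polynomial.eval_finsetSum]
  · intro n hn
    rw [h0 n (by simpa using hn)]
    simp

/-- If the zeros of finitely many entire functions of finite order cancel away from `w` in a
linear combination, then the same combination of logarithmic derivatives is a polynomial up to a
simple pole at `w`. -/
lemma exists_sum_logDeriv_eq_polynomial {ι : Type*} (S : Finset ι) {f : ι → ℂ → ℂ} {a : ι → ℂ}
    {c w : ℂ} (hf : ∀ i ∈ S, Differentiable ℂ (f i)) (hc : ∀ i ∈ S, f i c ≠ 0)
    (hA : ∀ i ∈ S, ∃ A : ℝ, ∀ z, ‖f i z‖ ≤ Real.exp (A * (1 + ‖z‖) ^ 2))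
    (hz : ∀ ρ, ρ ≠ w → ∑ i ∈ S, a i * analyticOrderNatAt (f i) ρ = 0) :
    ∃ (μ : ℂ) (P : Polynomial ℂ), ∀ z, z ≠ w → (∀ i ∈ S, f i z ≠ 0) →
      ∑ i ∈ S, a i * logDeriv (f i) z = μ / (z - w) + P.eval z := by
  classical
  set μ : ℂ := ∑ i ∈ S, a i * analyticOrderNatAt (f i) w with hμ
  set G : ℂ → ℂ := fun z ↦ ∑ i ∈ S, a i * logDeriv (f i) z - μ / (z - w) with hG
  have key : ∀ i, ∃ K : ℝ, i ∈ S → ∀ R, 1 ≤ R → ∀ Z : Finset ℂ,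
      (∀ z ∈ closedBall c R, f i z = 0 → z ∈ Z) → (∀ z ∈ Z, z ∈ closedBall c R) →
      ∃ h : ℂ → ℂ, Differentiable ℂ h ∧ (∀ z ∈ closedBall c R, h z ≠ 0) ∧
        (∀ z, f i z ≠ 0 →
          logDeriv (f i) z = ∑ ρ ∈ Z, analyticOrderNatAt (f i) ρ / (z - ρ) + logDeriv h z) ∧
        ∀ z ∈ ball c (R / 4), ‖logDeriv h z‖ ≤ K * R ^ 2 := by
    intro i
    by_cases hi : i ∈ S
    · obtain ⟨A, hA⟩ := hA i hi
      obtain ⟨K, hK⟩ := exists_logDeriv_eq_sum_add (hf i hi) (hc i hi) hA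
      exact ⟨K, fun _ ↦ hK⟩
    · exact ⟨0, fun h ↦ absurd h hi⟩
  choose K hK using key
  set R₀ : ℝ := max 1 (dist w c) with hR₀
  have local_rep : ∀ R, R₀ ≤ R → ∃ Ψ : ℂ → ℂ, (∀ z ∈ ball c (R / 4), DifferentiableAt ℂ Ψ z) ∧
      (∀ z, z ≠ w → (∀ i ∈ S, f i z ≠ 0) → G z = Ψ z) ∧
      ∀ z ∈ ball c (R / 4), ‖Ψ z‖ ≤ (∑ i ∈ S, ‖a i‖ * K i) * R ^ 2 := by
    intro R hR
    have hR1 : 1 ≤ R := (le_max_left _ _).trans hR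
    have hwR : w ∈ closedBall c R := (le_max_right _ _).trans hR
    have hfin : (⋃ i ∈ S, {z | z ∈ closedBall c R ∧ f i z = 0}).Finite :=
      S.finite_toSet.biUnion fun i hi ↦ finite_zeros_closedBall (hf i hi) (hc i hi) c R
    set Z : Finset ℂ := insert w hfin.toFinset with hZ
    have hZR : ∀ z ∈ Z, z ∈ closedBall c R := by
      intro z hz
      rw [hZ, Finset.mem_insert, Set.Finite.mem_toFinset] at hz
      rcases hz with rfl | hz
      · exact hwR
      · simp only [Set.mem_iUnion] at hz
        obtain ⟨i, -, hz⟩ := hz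
        exact hz.1
    have hh : ∀ i, ∃ h : ℂ → ℂ, i ∈ S → Differentiable ℂ h ∧ (∀ z ∈ closedBall c R, h z ≠ 0) ∧
        (∀ z, f i z ≠ 0 →
          logDeriv (f i) z = ∑ ρ ∈ Z, analyticOrderNatAt (f i) ρ / (z - ρ) + logDeriv h z) ∧
        ∀ z ∈ ball c (R / 4), ‖logDeriv h z‖ ≤ K i * R ^ 2 := by
      intro i
      by_cases hi : i ∈ S
      · obtain ⟨h, hh⟩ := hK i hi R hR1 Z (fun z hz h0 ↦ by
          rw [hZ, Finset.mem_insert, Set.Finite.mem_toFinset]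
          exact Or.inr (Set.mem_biUnion hi ⟨hz, h0⟩)) hZR
        exact ⟨h, fun _ ↦ hh⟩
      · exact ⟨0, fun h ↦ absurd h hi⟩
    choose h hh using hh
    refine ⟨fun z ↦ ∑ i ∈ S, a i * logDeriv (h i) z, fun z hz ↦ ?_, fun z hzw hz0 ↦ ?_,
      fun z hz ↦ ?_⟩
    · refine DifferentiableAt.fun_sum fun i hi ↦ DifferentiableAt.const_mul ?_ _
      have hzR : z ∈ closedBall c R := by
        rw [mem_ball] at hz; rw [mem_closedBall]; linarith
      exact ((hh i hi).1.analyticAt z).deriv.differentiableAt.div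
        ((hh i hi).1 z) ((hh i hi).2.1 z hzR)
    · have h1 : ∑ i ∈ S, a i * logDeriv (f i) z =
          ∑ ρ ∈ Z, (∑ i ∈ S, a i * analyticOrderNatAt (f i) ρ) / (z - ρ) +
            ∑ i ∈ S, a i * logDeriv (h i) z := by
        rw [Finset.sum_congr rfl fun i hi ↦ by rw [(hh i hi).2.2.1 z (hz0 i hi)]]
        simp_rw [mul_add, Finset.sum_add_distrib, Finset.mul_sum, Finset.sum_div]
        rw [Finset.sum_comm]
        simp_rw [mul_div_assoc]
      have h2 : ∑ ρ ∈ Z, (∑ i ∈ S, a i * analyticOrderNatAt (f i) ρ) / (z - ρ) = μ / (z - w) := by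
        rw [Finset.sum_eq_single_of_mem w (Finset.mem_insert_self _ _)]
        intro ρ _ hρ
        rw [hz ρ hρ, zero_div]
      simp only [hG]
      rw [h1, h2]
      ring
    · refine (norm_sum_le _ _).trans ?_
      rw [Finset.sum_mul]
      refine Finset.sum_le_sum fun i hi ↦ ?_
      rw [norm_mul, mul_assoc]
      exact mul_le_mul_of_nonneg_left ((hh i hi).2.2.2 z hz) (norm_nonneg _)
  choose! Ψ hΨd hΨ hΨb using local_rep
  have good : ∀ z, ∀ᶠ x in 𝓝[≠] z, x ≠ w ∧ ∀ i ∈ S, f i x ≠ 0 := by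
    intro z
    refine Filter.Eventually.and ?_ ?_
    · rcases eq_or_ne z w with rfl | hzw
      · exact eventually_mem_nhdsWithin
      · exact nhdsWithin_le_nhds (isOpen_ne.mem_nhds hzw)
    · rw [Filter.eventually_all_finset]
      exact fun i hi ↦ eventually_ne_zero_of_entire (hf i hi) (hc i hi) z
  set Q : ℂ → ℂ := fun z ↦ limUnder (𝓝[≠] z) G with hQ
  have hQΨ : ∀ R, R₀ ≤ R → ∀ z ∈ ball c (R / 4), Q z = Ψ R z := by
    intro R hR z hzb
    refine Tendsto.limUnder_eq ?_
    have := ((hΨd R hR z hzb).continuousAt.tendsto.mono_left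
      (nhdsWithin_le_nhds (s := {z}ᶜ)))
    refine this.congr' ?_
    filter_upwards [good z] with x hx
    exact (hΨ R hR x hx.1 hx.2).symm
  have hball : ∀ z, ∃ R, R₀ ≤ R ∧ z ∈ ball c (R / 4) := fun z ↦
    ⟨max R₀ (4 * (dist z c + 1)), le_max_left _ _, by
      have := le_max_right R₀ (4 * (dist z c + 1))
      rw [mem_ball]; linarith⟩
  have hQd : Differentiable ℂ Q := by
    intro z
    obtain ⟨R, hR, hz⟩ := hball z
    refine (hΨd R hR z hz).congr_of_eventuallyEq ?_
    filter_upwards [isOpen_ball.mem_nhds hz] with x hx using hQΨ R hR x hx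
  obtain ⟨P, hP⟩ := exists_polynomial_of_growth hQd (c := c) (R₀ := R₀)
    (K := ∑ i ∈ S, ‖a i‖ * K i) fun R hR z hz ↦ by
      rw [hQΨ R hR z hz]; exact hΨb R hR z hz
  refine ⟨μ, P, fun z hzw hz0 ↦ ?_⟩
  obtain ⟨R, hR, hz⟩ := hball z
  have := hΨ R hR z hzw hz0
  rw [← hQΨ R hR z hz, hP] at this
  simp only [hG] at this
  linear_combination this

/-- The residue of a logarithmic derivative, computed along a horizontal ray. -/
lemma tendsto_mul_logDeriv {f : ℂ → ℂ} (hf : Differentiable ℂ f) {c : ℂ} (hc : f c ≠ 0) (ρ : ℂ) :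
    Tendsto (fun t : ℝ ↦ (t : ℂ) * logDeriv f (ρ + t)) (𝓝[>] 0)
      (𝓝 (analyticOrderNatAt f ρ)) := by
  obtain ⟨g, hg, hg0, hfg⟩ := exists_entire_factor hf (analyticOrderAt_ne_top_of_entire hf hc ρ)
  set m := analyticOrderNatAt f ρ
  have hfun : f = fun z ↦ (z - ρ) ^ m * g z := funext hfg
  have hT : Tendsto (fun t : ℝ ↦ ρ + (t : ℂ)) (𝓝[>] 0) (𝓝 ρ) := by
    have : Continuous fun t : ℝ ↦ ρ + (t : ℂ) := by fun_prop
    simpa using (this.tendsto 0).mono_left nhdsWithin_le_nhds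
  have hlog : ContinuousAt (logDeriv g) ρ :=
    ((hg.analyticAt ρ).deriv.continuousAt).div (hg ρ).continuousAt hg0
  have ht0 : Tendsto (fun t : ℝ ↦ (t : ℂ)) (𝓝[>] 0) (𝓝 0) := by
    simpa using (Complex.continuous_ofReal.tendsto 0).mono_left nhdsWithin_le_nhds
  have h1 : Tendsto (fun t : ℝ ↦ (m : ℂ) + (t : ℂ) * logDeriv g (ρ + t)) (𝓝[>] 0) (𝓝 m) := by
    simpa using (ht0.mul (hlog.tendsto.comp hT)).const_add (m : ℂ)
  refine h1.congr' ?_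
  have hne : ∀ᶠ t : ℝ in 𝓝[>] 0, g (ρ + t) ≠ 0 :=
    hT.eventually (hg.continuous.continuousAt.eventually_ne hg0)
  filter_upwards [hne, self_mem_nhdsWithin] with t hgt ht
  have ht' : (t : ℂ) ≠ 0 := by exact_mod_cast (Set.mem_Ioi.mp ht).ne'
  rw [hfun, logDeriv_mul (f := fun z : ℂ ↦ (z - ρ) ^ m) (ρ + t : ℂ)
    (pow_ne_zero _ (by simpa using ht')) hgt
    (by fun_prop) (hg _), logDeriv_fun_pow (by fun_prop)]
  have : logDeriv (fun z : ℂ ↦ z - ρ) (ρ + t) = 1 / t := by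
    simp [logDeriv_apply]
  rw [this]
  field_simp

/-- A Dirichlet series with bounded coefficients and bounded partial sums continues to the
half-plane `0 < re s`, with a linear growth bound. -/
lemma exists_continuation_of_bounded_sums {a : ℕ → ℂ} {M C : ℝ} (ha : ∀ n ≠ 0, ‖a n‖ ≤ M)
    (hC : ∀ n, ‖∑ k ∈ Finset.Icc 1 n, a k‖ ≤ C) :
    ∃ E : ℂ → ℂ, (∀ s, 0 < s.re → DifferentiableAt ℂ E s) ∧
      (∀ s, 0 < s.re → ‖E s‖ ≤ C * ‖s‖ / s.re) ∧ ∀ s, 1 < s.re → LSeries a s = E s := by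
  set S : ℝ → ℂ := fun t ↦ ∑ k ∈ Finset.Icc 1 ⌊t⌋₊, a k with hS
  have hSm : Measurable S :=
    (measurable_from_top (f := fun n : ℕ ↦ ∑ k ∈ Finset.Icc 1 n, a k)).comp Nat.measurable_floor
  set f : ℝ → ℂ := (Set.Ioi 1).indicator S with hf
  have hfm : Measurable f := hSm.indicator measurableSet_Ioi
  have hC0 : 0 ≤ C := (norm_nonneg _).trans (hC 0)
  have hfC : ∀ t, ‖f t‖ ≤ C := fun t ↦ (norm_indicator_le_norm_self _ _).trans (hC _)
  have hmellin : ∀ s, mellin f (-s) = ∫ t in Set.Ioi (1 : ℝ), S t * (t : ℂ) ^ (-(s + 1)) := by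
    intro s
    rw [mellin, ← MeasureTheory.integral_indicator measurableSet_Ioi,
      ← MeasureTheory.integral_indicator measurableSet_Ioi]
    congr 1
    ext t
    by_cases ht : 1 < t
    · have ht0 : 0 < t := by linarith
      simp only [Set.indicator, Set.mem_Ioi, ht, ht0, if_true, hf, smul_eq_mul]
      rw [mul_comm, neg_add']
    · simp [Set.indicator, hf, ht]
  refine ⟨fun s ↦ s * mellin f (-s), fun s hs ↦ ?_, fun s hs ↦ ?_, fun s hs ↦ ?_⟩
  · have : DifferentiableAt ℂ (mellin f) (-s) := by
      refine mellin_differentiableAt_of_isBigO_rpow (a := 0) (b := (-s).re - 1) ?_ ?_ ?_ ?_ ?_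
      · refine MeasureTheory.LocallyIntegrable.locallyIntegrableOn ?_ _
        exact (MeasureTheory.locallyIntegrable_const C).mono hfm.aestronglyMeasurable
          (Eventually.of_forall fun t ↦ (hfC t).trans (le_abs_self _))
      · refine Asymptotics.IsBigO.of_bound C (Eventually.of_forall fun t ↦ ?_)
        simpa using hfC t
      · simpa using hs
      · refine Asymptotics.IsBigO.of_bound 0 ?_
        filter_upwards [nhdsWithin_le_nhds (Iio_mem_nhds zero_lt_one)] with t ht
        have : f t = 0 := Set.indicator_of_notMem (by simpa using ht.le) _
        simp [this]
      · simp
    exact differentiableAt_id.mul (this.comp s differentiableAt_id.neg)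
  · rw [norm_mul, hmellin]
    have h1 : ‖∫ t in Set.Ioi (1 : ℝ), S t * (t : ℂ) ^ (-(s + 1))‖ ≤
        ∫ t in Set.Ioi (1 : ℝ), C * t ^ (-(s.re + 1)) := by
      refine MeasureTheory.norm_integral_le_of_norm_le ?_ ?_
      · exact (integrableOn_Ioi_rpow_of_lt (by linarith) zero_lt_one).const_mul C
      · refine (MeasureTheory.ae_restrict_iff' measurableSet_Ioi).mpr
          (Eventually.of_forall fun t ht ↦ ?_)
        have ht0 : (0 : ℝ) < t := zero_lt_one.trans ht
        rw [norm_mul, Complex.norm_cpow_eq_rpow_re_of_pos ht0]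
        simp only [Complex.neg_re, Complex.add_re, Complex.one_re]
        gcongr
        exact hC _
    rw [MeasureTheory.integral_const_mul, integral_Ioi_rpow_of_lt (by linarith) zero_lt_one] at h1
    have h2 : C * (-1 ^ (-(s.re + 1) + 1) / (-(s.re + 1) + 1)) = C / s.re := by
      have : -(s.re + 1) + 1 = -s.re := by ring
      rw [this, Real.one_rpow, neg_div_neg_eq]
      ring
    rw [h2] at h1
    calc _ ≤ ‖s‖ * (C / s.re) := by gcongr
      _ = _ := by ring
  · have hs0 : (0 : ℝ) < s.re := by linarith
    simp only [hmellin]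
    refine LSeries_eq_mul_integral a le_rfl hs0 (LSeriesSummable_of_bounded_of_one_lt_re ha hs) ?_
    refine Asymptotics.IsBigO.of_bound C (Eventually.of_forall fun n ↦ ?_)
    simpa using hC n

open Classical in
/-- The alternating sum over the primes of the signs attached to `POdd` stays in `{0, 1}`. -/
lemma sum_range_sign_POdd (n : ℕ) :
    ∑ k ∈ Finset.range n, (if k.Prime then (if k ∈ POdd then (1 : ℂ) else -1) else 0) =
      if Even (Nat.count Nat.Prime n) then 0 else 1 := by
  induction n with
  | zero => simp
  | succ n ih =>
    rw [Finset.sum_range_succ, ih, Nat.count_succ]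
    by_cases hn : n.Prime
    · have : n ∈ POdd ↔ Even (Nat.count Nat.Prime n) := by
        constructor
        · rintro ⟨m, hm, h⟩
          rwa [h, Nat.count_nth_of_infinite Nat.infinite_setOfPred_prime]
        · intro h
          exact ⟨_, h, (Nat.nth_count hn).symm⟩
      by_cases he : Even (Nat.count Nat.Prime n)
      · simp [hn, he, this, Nat.even_add_one]
      · simp [hn, he, this, Nat.even_add_one]
    · simp [hn]

open Classical in
lemma exists_bound_sum_of_eq_sign_POdd {u : ℕ → ℂ} {T : Set ℕ}
    (hT : T.Finite) (h0 : ∀ n, ¬ n.Prime → u n = 0)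
    (h1 : ∀ p, p.Prime → p ∉ T → u p = if p ∈ POdd then 1 else -1) :
    ∃ C : ℝ, ∀ n, ‖∑ k ∈ Finset.range n, u k‖ ≤ C := by
  set e : ℕ → ℂ := fun k ↦ if k.Prime then (if k ∈ POdd then (1 : ℂ) else -1) else 0 with he
  refine ⟨1 + ∑ k ∈ hT.toFinset, ‖u k - e k‖, fun n ↦ ?_⟩
  have hsplit : ∑ k ∈ Finset.range n, u k =
      ∑ k ∈ Finset.range n, e k + ∑ k ∈ Finset.range n, (u k - e k) := by
    rw [Finset.sum_sub_distrib]; ring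
  rw [hsplit, sum_range_sign_POdd]
  refine (norm_add_le _ _).trans (add_le_add ?_ ?_)
  · split_ifs <;> simp
  · refine (norm_sum_le _ _).trans ?_
    rw [← Finset.sum_filter_add_sum_filter_not (Finset.range n) (· ∈ T)]
    have hz : ∑ k ∈ Finset.range n with k ∉ T, ‖u k - e k‖ = 0 := by
      refine Finset.sum_eq_zero fun k hk ↦ ?_
      have hk := (Finset.mem_filter.mp hk).2
      by_cases hp : k.Prime
      · simp [he, hp, h1 k hp hk]
      · simp [he, hp, h0 k hp]
    rw [hz, add_zero]
    refine Finset.sum_le_sum_of_subset_of_nonneg (fun k hk ↦ ?_) fun _ _ _ ↦ norm_nonneg _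
    simpa using (Finset.mem_filter.mp hk).2

/-- The Dirichlet series `∑ log p · ψ(p) p⁻ˢ` over the primes. -/
noncomputable def primeLogSum (ψ : ℕ → ℂ) (s : ℂ) : ℂ :=
  ∑' p : Nat.Primes, Real.log p * (ψ p * (p : ℂ) ^ (-s))

/-- The tail from the `k`-th term on of the logarithmic derivative of an Euler product. -/
noncomputable def primeLogTail (k : ℕ) (ψ : ℕ → ℂ) (s : ℂ) : ℂ :=
  ∑' p : Nat.Primes,
    Real.log p * ((ψ p * (p : ℂ) ^ (-s)) ^ k / (1 - ψ p * (p : ℂ) ^ (-s)))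

lemma summable_log_mul_rpow_primes {a : ℝ} (ha : 1 < a) :
    Summable fun p : Nat.Primes ↦ Real.log p * (p : ℝ) ^ (-a) := by
  have hε : 0 < (a - 1) / 2 := by linarith
  have hs : Summable fun p : Nat.Primes ↦ (p : ℝ) ^ ((a - 1) / 2 - a) / ((a - 1) / 2) :=
    (Nat.Primes.summable_rpow.mpr (by linarith)).div_const _
  refine hs.of_nonneg_of_le (fun p ↦ ?_) fun p ↦ ?_
  · have : (1 : ℝ) ≤ p := by exact_mod_cast p.2.one_le
    have := Real.log_nonneg this
    positivity
  · have hp : (0 : ℝ) < p := by exact_mod_cast p.2.pos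
    rw [sub_eq_add_neg, Real.rpow_add hp, mul_div_right_comm]
    have := Real.log_le_rpow_div hp.le hε
    gcongr

lemma norm_mul_prime_cpow_le {ψ : ℕ → ℂ} (hψ : ∀ n, ‖ψ n‖ ≤ 1) (p : Nat.Primes) {s : ℂ} {σ : ℝ}
    (hs : σ ≤ s.re) : ‖ψ p * (p : ℂ) ^ (-s)‖ ≤ (p : ℝ) ^ (-σ) := by
  rw [norm_mul, Complex.norm_natCast_cpow_of_pos p.2.pos, Complex.neg_re]
  have hp : (1 : ℝ) ≤ p := by exact_mod_cast p.2.one_le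
  calc _ ≤ 1 * (p : ℝ) ^ (-σ) := by
        gcongr
        · exact hψ p
      _ = _ := one_mul _

lemma prime_rpow_neg_le (p : Nat.Primes) {σ : ℝ} (hσ : 0 ≤ σ) :
    (p : ℝ) ^ (-σ) ≤ 2 ^ (-σ) :=
  Real.rpow_le_rpow_of_nonpos (by norm_num) (by exact_mod_cast p.2.two_le) (by linarith)

lemma one_sub_ne_zero_of_norm_lt {z : ℂ} (hz : ‖z‖ < 1) : 1 - z ≠ 0 := by
  intro h
  rw [← sub_eq_zero.mp h] at hz
  simp at hz

lemma norm_mul_prime_cpow_lt_one {ψ : ℕ → ℂ} (hψ : ∀ n, ‖ψ n‖ ≤ 1) (p : Nat.Primes) {s : ℂ}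
    (hs : 0 < s.re) : ‖ψ p * (p : ℂ) ^ (-s)‖ < 1 :=
  ((norm_mul_prime_cpow_le hψ p le_rfl).trans (prime_rpow_neg_le p hs.le)).trans_lt
    (Real.rpow_lt_one_of_one_lt_of_neg (by norm_num) (by linarith))

lemma norm_primeLogTail_term_le {ψ : ℕ → ℂ} (hψ : ∀ n, ‖ψ n‖ ≤ 1) (k : ℕ) (p : Nat.Primes) {s : ℂ}
    {σ : ℝ} (hσ : 0 < σ) (hs : σ ≤ s.re) :
    ‖Real.log p * ((ψ p * (p : ℂ) ^ (-s)) ^ k / (1 - ψ p * (p : ℂ) ^ (-s)))‖ ≤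
      Real.log p * (p : ℝ) ^ (-(k * σ)) * (1 - 2 ^ (-σ))⁻¹ := by
  have hz := norm_mul_prime_cpow_le hψ p hs
  have h2 : (2 : ℝ) ^ (-σ) < 1 := Real.rpow_lt_one_of_one_lt_of_neg (by norm_num) (by linarith)
  set z := ψ p * (p : ℂ) ^ (-s)
  have hp : (1 : ℝ) ≤ p := by exact_mod_cast p.2.one_le
  have hlog := Real.log_nonneg hp
  have h1 : 1 - 2 ^ (-σ) ≤ ‖1 - z‖ := by
    have h3 := norm_sub_norm_le 1 z
    rw [norm_one] at h3
    linarith [prime_rpow_neg_le p hσ.le]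
  have hpk : (p : ℝ) ^ (-(k * σ)) = ((p : ℝ) ^ (-σ)) ^ k := by
    rw [← Real.rpow_natCast, ← Real.rpow_mul (by positivity)]
    ring_nf
  rw [norm_mul, norm_div, norm_pow, Complex.norm_real, Real.norm_of_nonneg hlog, hpk, mul_assoc,
    div_eq_mul_inv]
  have : 0 < 1 - (2 : ℝ) ^ (-σ) := by linarith
  gcongr

lemma summable_primeLogTail {ψ : ℕ → ℂ} (hψ : ∀ n, ‖ψ n‖ ≤ 1) {k : ℕ} {s : ℂ}
    (hs0 : 0 < s.re) (hs : 1 < k * s.re) :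
    Summable fun p : Nat.Primes ↦
      (Real.log p * ((ψ p * (p : ℂ) ^ (-s)) ^ k / (1 - ψ p * (p : ℂ) ^ (-s))) : ℂ) :=
  ((summable_log_mul_rpow_primes hs).mul_right _).of_norm_bounded fun p ↦
    norm_primeLogTail_term_le hψ k p hs0 le_rfl

lemma summable_primeLogSum {ψ : ℕ → ℂ} (hψ : ∀ n, ‖ψ n‖ ≤ 1) {s : ℂ} (hs : 1 < s.re) :
    Summable fun p : Nat.Primes ↦ (Real.log p * (ψ p * (p : ℂ) ^ (-s)) : ℂ) := by
  refine (summable_log_mul_rpow_primes hs).of_norm_bounded fun p ↦ ?_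
  have hlog : 0 ≤ Real.log p := Real.log_nonneg (by exact_mod_cast p.2.one_le)
  rw [norm_mul, Complex.norm_real, Real.norm_of_nonneg hlog]
  exact mul_le_mul_of_nonneg_left (norm_mul_prime_cpow_le hψ p le_rfl) hlog

lemma differentiable_mul_prime_cpow (ψ : ℕ → ℂ) (p : Nat.Primes) :
    Differentiable ℂ fun s : ℂ ↦ ψ p * (p : ℂ) ^ (-s) := fun _ ↦
  ((differentiableAt_id.neg).const_cpow (Or.inl (by exact_mod_cast p.2.ne_zero))).const_mul _

lemma differentiableAt_primeLogTail {ψ : ℕ → ℂ} (hψ : ∀ n, ‖ψ n‖ ≤ 1) {k : ℕ} {s : ℂ}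
    (hs0 : 0 < s.re) (hs : 1 < k * s.re) : DifferentiableAt ℂ (primeLogTail k ψ) s := by
  have hk : (0 : ℝ) < k := by
    by_contra! h
    nlinarith
  obtain ⟨σ, hσ, hσs⟩ := exists_between ((div_lt_iff₀' hk).mpr hs)
  have hσ0 : 0 < σ := (by positivity : (0 : ℝ) < 1 / k).trans hσ
  have hU : IsOpen {w : ℂ | σ < w.re} := isOpen_lt continuous_const Complex.continuous_re
  refine (Complex.differentiableOn_tsum_of_summable_norm
    ((summable_log_mul_rpow_primes ((div_lt_iff₀' hk).mp hσ)).mul_right _) (fun p ↦ ?_) hU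
    fun p w hw ↦ norm_primeLogTail_term_le hψ k p hσ0 (le_of_lt hw)).differentiableAt
      (hU.mem_nhds hσs)
  intro w hw
  have h1 := differentiable_mul_prime_cpow ψ p w
  have h2 := one_sub_ne_zero_of_norm_lt (norm_mul_prime_cpow_lt_one hψ p (hσ0.trans hw))
  exact (((h1.pow k).div (h1.const_sub 1) h2).const_mul _).differentiableWithinAt

lemma primeLogTail_one {ψ : ℕ → ℂ} (hψ : ∀ n, ‖ψ n‖ ≤ 1) {s : ℂ} (hs : 1 < s.re) :
    primeLogTail 1 ψ s = primeLogSum ψ s + primeLogTail 2 ψ s := by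
  have hs0 : 0 < s.re := by linarith
  rw [primeLogTail, primeLogSum, primeLogTail, ← (summable_primeLogSum hψ hs).tsum_add
    (summable_primeLogTail hψ hs0 (by push_cast; linarith))]
  congr with p
  have := one_sub_ne_zero_of_norm_lt (norm_mul_prime_cpow_lt_one hψ p hs0)
  field_simp
  ring

lemma primeLogTail_two {ψ : ℕ → ℂ} (hψ : ∀ n, ‖ψ n‖ ≤ 1) {s : ℂ} (hs : 1 / 2 < s.re) :
    primeLogTail 2 ψ s = primeLogSum (fun n ↦ ψ n ^ 2) (2 * s) + primeLogTail 3 ψ s := by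
  have hs0 : 0 < s.re := by linarith
  have hs2 : 1 < (2 * s).re := by simp; linarith
  rw [primeLogTail, primeLogSum, primeLogTail, ← (summable_primeLogSum (ψ := fun n ↦ ψ n ^ 2)
    (fun n ↦ by rw [norm_pow]; exact pow_le_one₀ (norm_nonneg _) (hψ n)) hs2).tsum_add
    (summable_primeLogTail hψ hs0 (by push_cast; linarith))]
  congr with p
  have := one_sub_ne_zero_of_norm_lt (norm_mul_prime_cpow_lt_one hψ p hs0)
  have h2 : (p : ℂ) ^ (-(2 * s)) = ((p : ℂ) ^ (-s)) ^ 2 := by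
    rw [← Complex.cpow_nat_mul]; push_cast; ring_nf
  rw [h2]
  field_simp
  ring

/-- The logarithmic derivative of a Dirichlet `L`-series as a sum over primes. -/
lemma logDeriv_LSeries_eq_neg_primeLogTail {N : ℕ} (χ : DirichletCharacter ℂ N) {s : ℂ}
    (hs : 1 < s.re) :
    logDeriv (LSeries fun n ↦ χ n) s = -primeLogTail 1 (fun n ↦ χ n) s := by
  have hχ : ∀ n : ℕ, ‖χ n‖ ≤ 1 := fun n ↦ χ.norm_le_one _
  obtain ⟨σ, hσ1, hσ⟩ := exists_between hs
  have hU : IsOpen {w : ℂ | σ < w.re} := isOpen_lt continuous_const Complex.continuous_re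
  set F : Nat.Primes → ℂ → ℂ := fun p w ↦ -Complex.log (1 - χ p * (p : ℂ) ^ (-w)) with hF
  have hlt : ∀ (p : Nat.Primes) (w : ℂ), σ < w.re → ‖χ p * (p : ℂ) ^ (-w)‖ < 1 :=
    fun p w hw ↦ norm_mul_prime_cpow_lt_one (ψ := fun n ↦ χ n) hχ p (by linarith)
  have hslit : ∀ (p : Nat.Primes) (w : ℂ), σ < w.re →
      1 - χ p * (p : ℂ) ^ (-w) ∈ Complex.slitPlane := fun p w hw ↦ by
    have := Complex.mem_slitPlane_of_norm_lt_one (z := -(χ p * (p : ℂ) ^ (-w)))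
      (by simpa using hlt p w hw)
    rwa [← sub_eq_add_neg] at this
  have hzd := fun p : Nat.Primes ↦ differentiable_mul_prime_cpow (fun n ↦ χ n) p
  have hd : ∀ p, DifferentiableOn ℂ (F p) {w : ℂ | σ < w.re} := fun p w hw ↦
    (((hzd p w).const_sub 1).clog (hslit p w hw)).neg.differentiableWithinAt
  have hsum : Summable fun p : Nat.Primes ↦ 3 / 2 * (p : ℝ) ^ (-σ) :=
    (Nat.Primes.summable_rpow.mpr (by linarith)).mul_left _
  have hbd : ∀ (p : Nat.Primes) w, w ∈ {w : ℂ | σ < w.re} → ‖F p w‖ ≤ 3 / 2 * (p : ℝ) ^ (-σ) := by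
    intro p w hw
    have h1 := norm_mul_prime_cpow_le (ψ := fun n ↦ χ n) hχ p (le_of_lt hw)
    have h2 : (p : ℝ) ^ (-σ) ≤ 1 / 2 := by
      refine (prime_rpow_neg_le p (by linarith)).trans ?_
      calc (2 : ℝ) ^ (-σ) ≤ 2 ^ (-1 : ℝ) := by
            apply Real.rpow_le_rpow_of_exponent_le <;> linarith
        _ = 1 / 2 := by rw [Real.rpow_neg_one]; norm_num
    have := Complex.norm_log_one_add_half_le_self (z := -(χ p * (p : ℂ) ^ (-w)))
      (by rw [norm_neg]; exact h1.trans h2)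
    rw [← sub_eq_add_neg, norm_neg] at this
    rw [hF, norm_neg]
    exact this.trans (by gcongr)
  have hder := Complex.hasSum_deriv_of_summable_norm hsum hd hU hbd hσ
  have hdiff := (Complex.differentiableOn_tsum_of_summable_norm hsum hd hU hbd).differentiableAt
    (hU.mem_nhds hσ)
  have heq : LSeries (fun n ↦ χ n) =ᶠ[𝓝 s] fun w ↦ Complex.exp (∑' p, F p w) := by
    filter_upwards [hU.mem_nhds hσ] with w hw
    exact (χ.LSeries_eulerProduct_exp_log (hσ1.trans hw)).symm
  rw [logDeriv_apply, heq.deriv_eq, heq.self_of_nhds, deriv_cexp hdiff,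
    mul_div_cancel_left₀ _ (Complex.exp_ne_zero _), ← hder.tsum_eq, primeLogTail, ← tsum_neg]
  congr with p
  have hp0 : (p : ℂ) ≠ 0 := by exact_mod_cast p.2.ne_zero
  have h1 : HasDerivAt (fun w ↦ 1 - χ p * (p : ℂ) ^ (-w))
      (-(χ p * ((p : ℂ) ^ (-s) * Complex.log p * -1))) s :=
    (((hasDerivAt_id s).neg.const_cpow (Or.inl hp0)).const_mul _).const_sub 1
  have h2 := (h1.clog (hslit p s hσ)).neg
  rw [show F p = -fun t ↦ Complex.log (1 - χ p * (p : ℂ) ^ (-t)) from rfl, h2.deriv,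
    Complex.natCast_log]
  ring

/-- A prime-supported Dirichlet series differentiates to a sum over primes. -/
lemma deriv_LSeries_eq_neg_primeLogSum {u : ℕ → ℂ} {M : ℝ} (hM : ∀ n, ‖u n‖ ≤ M)
    (hu : ∀ n, ¬ n.Prime → u n = 0) {s : ℂ} (hs : 1 < s.re) :
    deriv (LSeries u) s = -primeLogSum u s := by
  have habs : LSeries.abscissaOfAbsConv u ≤ 1 :=
    LSeries.abscissaOfAbsConv_le_one_of_isBigO_one
      (Asymptotics.IsBigO.of_bound M (Eventually.of_forall fun n ↦ by simpa using hM n))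
  rw [LSeries_deriv (habs.trans_lt (by exact_mod_cast hs)), LSeries, primeLogSum]
  congr 1
  rw [← tsum_subtype_eq_of_support_subset (s := {p : ℕ | p.Prime})]
  · refine tsum_congr fun p : Nat.Primes ↦ ?_
    rw [LSeries.term_of_ne_zero p.2.ne_zero, LSeries.logMul, Complex.cpow_neg, Complex.natCast_log]
    ring
  · intro n hn
    by_contra h
    refine hn ?_
    rw [LSeries.term_def, LSeries.logMul, hu n h]
    simp

lemma tendsto_add_ofReal_nhdsGT (ρ : ℂ) :
    Tendsto (fun t : ℝ ↦ ρ + (t : ℂ)) (𝓝[>] 0) (𝓝 ρ) := by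
  have : Continuous fun t : ℝ ↦ ρ + (t : ℂ) := by fun_prop
  simpa using (this.tendsto 0).mono_left nhdsWithin_le_nhds

lemma tendsto_ofReal_nhdsGT_zero : Tendsto (fun t : ℝ ↦ (t : ℂ)) (𝓝[>] 0) (𝓝 0) := by
  simpa using tendsto_add_ofReal_nhdsGT 0

lemma ContinuousAt.tendsto_ofReal_mul_nhdsGT {f : ℂ → ℂ} {ρ : ℂ} (hf : ContinuousAt f ρ) :
    Tendsto (fun t : ℝ ↦ (t : ℂ) * f (ρ + t)) (𝓝[>] 0) (𝓝 0) := by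
  simpa using tendsto_ofReal_nhdsGT_zero.mul (hf.tendsto.comp (tendsto_add_ofReal_nhdsGT ρ))

lemma differentiableAt_Gammaℝ {s : ℂ} (hs : 0 < s.re) : DifferentiableAt ℂ Complex.Gammaℝ s := by
  have := (Complex.differentiable_Gammaℝ_inv s).inv
    (inv_ne_zero (Complex.Gammaℝ_ne_zero_of_re_pos hs))
  refine this.congr_of_eventuallyEq (Eventually.of_forall fun z ↦ ?_)
  simp

namespace DirichletCharacter

variable {N : ℕ} (χ : DirichletCharacter ℂ N)

lemma exists_gammaFactor_eq :
    ∃ a : ℝ, (a = 0 ∨ a = 1) ∧ ∀ s, χ.gammaFactor s = Complex.Gammaℝ (s + a) := by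
  rcases χ.even_or_odd with h | h
  · exact ⟨0, Or.inl rfl, fun s ↦ by simp [h.gammaFactor_def]⟩
  · exact ⟨1, Or.inr rfl, fun s ↦ by simp [h.gammaFactor_def]⟩

lemma gammaFactor_ne_zero {s : ℂ} (hs : 0 < s.re) : χ.gammaFactor s ≠ 0 := by
  obtain ⟨a, ha, h⟩ := χ.exists_gammaFactor_eq
  rw [h]
  refine Complex.Gammaℝ_ne_zero_of_re_pos ?_
  rcases ha with rfl | rfl <;> simp <;> linarith

lemma differentiableAt_gammaFactor {s : ℂ} (hs : 0 < s.re) :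
    DifferentiableAt ℂ χ.gammaFactor s := by
  obtain ⟨a, ha, h⟩ := χ.exists_gammaFactor_eq
  rw [show χ.gammaFactor = fun s ↦ Complex.Gammaℝ (s + a) from funext h]
  refine (differentiableAt_Gammaℝ ?_).comp s (differentiableAt_id.add_const _)
  rcases ha with rfl | rfl <;> simp <;> linarith

variable [NeZero N]

lemma completedLFunction_eq_mul {s : ℂ} (hs : 0 < s.re) :
    χ.completedLFunction s = χ.LFunction s * χ.gammaFactor s := by
  have hs0 : s ≠ 0 := by rintro rfl; simp at hs
  rw [χ.LFunction_eq_completed_div_gammaFactor s (Or.inl hs0),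
    div_mul_cancel₀ _ (χ.gammaFactor_ne_zero hs)]

lemma analyticOrderNatAt_completedLFunction (hχ : χ ≠ 1) {ρ : ℂ} (hρ : 0 < ρ.re) :
    analyticOrderNatAt χ.completedLFunction ρ = analyticOrderNatAt χ.LFunction ρ := by
  have hU : IsOpen {w : ℂ | 0 < w.re} := isOpen_lt continuous_const Complex.continuous_re
  have hγ : AnalyticAt ℂ χ.gammaFactor ρ := by
    have : DifferentiableOn ℂ χ.gammaFactor {w : ℂ | 0 < w.re} := fun w hw ↦
      (χ.differentiableAt_gammaFactor hw).differentiableWithinAt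
    exact this.analyticAt (hU.mem_nhds hρ)
  have heq : χ.completedLFunction =ᶠ[𝓝 ρ] χ.LFunction * χ.gammaFactor := by
    filter_upwards [hU.mem_nhds hρ] with w hw using χ.completedLFunction_eq_mul hw
  rw [analyticOrderNatAt, analyticOrderAt_congr heq,
    analyticOrderAt_mul ((differentiable_LFunction hχ).analyticAt ρ) hγ,
    hγ.analyticOrderAt_eq_zero.mpr (χ.gammaFactor_ne_zero hρ), add_zero, analyticOrderNatAt]

lemma logDeriv_LFunction_eq {s : ℂ} (hs : 1 < s.re) :
    logDeriv χ.LFunction s = -primeLogTail 1 (fun n ↦ χ n) s := by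
  rw [← logDeriv_LSeries_eq_neg_primeLogTail χ hs]
  have hU : IsOpen {w : ℂ | 1 < w.re} := isOpen_lt continuous_const Complex.continuous_re
  have heq : χ.LFunction =ᶠ[𝓝 s] LSeries fun n ↦ χ n := by
    filter_upwards [hU.mem_nhds hs] with w hw using χ.LFunction_eq_LSeries hw
  rw [logDeriv_apply, logDeriv_apply, heq.deriv_eq, heq.self_of_nhds]

lemma continuousAt_logDeriv_LFunction {s : ℂ} (hs : 1 ≤ s.re) (h : χ ≠ 1 ∨ s ≠ 1) :
    ContinuousAt (logDeriv χ.LFunction) s := by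
  have h0 := χ.LFunction_ne_zero_of_one_le_re h hs
  have han : AnalyticAt ℂ χ.LFunction s := by
    rw [Complex.analyticAt_iff_eventually_differentiableAt]
    rcases h with h | h
    · exact Eventually.of_forall fun w ↦ differentiable_LFunction h w
    · filter_upwards [isOpen_ne.mem_nhds h] with w hw
      exact χ.differentiableAt_LFunction w (Or.inl hw)
  exact han.deriv.continuousAt.div han.continuousAt h0

lemma tendsto_mul_primeLogTail_two {ρ : ℂ} (hρ : 1 / 2 ≤ ρ.re) (hρ2 : ρ ≠ 1 / 2) :
    Tendsto (fun t : ℝ ↦ (t : ℂ) * primeLogTail 2 (fun n ↦ χ n) (ρ + t)) (𝓝[>] 0) (𝓝 0) := by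
  have hχ : ∀ n : ℕ, ‖χ n‖ ≤ 1 := fun n ↦ χ.norm_le_one _
  have hχ2 : ∀ n : ℕ, ‖(χ ^ 2) n‖ ≤ 1 := fun n ↦ (χ ^ 2).norm_le_one _
  set f : ℂ → ℂ := fun s ↦ -logDeriv (χ ^ 2).LFunction (2 * s) -
    primeLogTail 2 (fun n ↦ (χ ^ 2) n) (2 * s) + primeLogTail 3 (fun n ↦ χ n) s with hf
  have hmul : ContinuousAt (fun s : ℂ ↦ 2 * s) ρ := by fun_prop
  have hre : (2 * ρ).re = 2 * ρ.re := by simp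
  have hcont : ContinuousAt f ρ := by
    have h1 : ContinuousAt (fun s ↦ logDeriv (χ ^ 2).LFunction (2 * s)) ρ := by
      refine ContinuousAt.comp (g := logDeriv (χ ^ 2).LFunction) ?_ hmul
      refine (χ ^ 2).continuousAt_logDeriv_LFunction (by linarith) (Or.inr fun h ↦ hρ2 ?_)
      linear_combination h / 2
    have h2 : ContinuousAt (fun s ↦ primeLogTail 2 (fun n ↦ (χ ^ 2) n) (2 * s)) ρ :=
      ContinuousAt.comp (g := primeLogTail 2 (fun n ↦ (χ ^ 2) n))
        (differentiableAt_primeLogTail hχ2 (by linarith) (by push_cast; linarith)).continuousAt hmul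
    exact (h1.neg.sub h2).add
      (differentiableAt_primeLogTail hχ (by linarith) (by push_cast; linarith)).continuousAt
  refine hcont.tendsto_ofReal_mul_nhdsGT.congr' ?_
  filter_upwards [self_mem_nhdsWithin] with t ht
  have ht0 : 0 < t := ht
  have hs : 1 / 2 < (ρ + t : ℂ).re := by simp; linarith
  have hs2 : 1 < (2 * (ρ + t : ℂ)).re := by simp at hs ⊢; linarith
  have hsq : (fun n : ℕ ↦ (χ n) ^ 2) = fun n : ℕ ↦ (χ ^ 2) n := by
    ext n; rw [MulChar.pow_apply' _ two_ne_zero]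
  rw [primeLogTail_two hχ hs, hsq, hf]
  simp only
  rw [(χ ^ 2).logDeriv_LFunction_eq hs2, primeLogTail_one hχ2 hs2]
  ring

lemma tendsto_mul_logDeriv_LFunction_one :
    Tendsto (fun t : ℝ ↦ (t : ℂ) * logDeriv (1 : DirichletCharacter ℂ N).LFunction (1 + t))
      (𝓝[>] 0) (𝓝 (-1)) := by
  have hd := differentiable_LFunctionTrivChar₁ N
  have h1 := LFunctionTrivChar₁_apply_one_ne_zero N
  have hcont : ContinuousAt (logDeriv (LFunctionTrivChar₁ N)) 1 :=
    (hd.analyticAt 1).deriv.continuousAt.div (hd 1).continuousAt h1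
  have hlim := hcont.tendsto_ofReal_mul_nhdsGT.sub_const 1
  rw [zero_sub] at hlim
  refine hlim.congr' ?_
  filter_upwards [self_mem_nhdsWithin] with t ht
  have ht0 : (t : ℂ) ≠ 0 := by exact_mod_cast (Set.mem_Ioi.mp ht).ne'
  have hne : (1 + t : ℂ) ≠ 1 := by simpa using ht0
  have hre : 1 ≤ (1 + t : ℂ).re := by simp; exact (Set.mem_Ioi.mp ht).le
  have heq : LFunctionTrivChar₁ N =ᶠ[𝓝 (1 + t : ℂ)]
      fun s ↦ (s - 1) * (1 : DirichletCharacter ℂ N).LFunction s := by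
    filter_upwards [isOpen_ne.mem_nhds hne] with w hw
    rw [LFunctionTrivChar₁, Function.update_of_ne hw]
  have hL0 := (1 : DirichletCharacter ℂ N).LFunction_ne_zero_of_one_le_re (Or.inr hne) hre
  have hLd := (1 : DirichletCharacter ℂ N).differentiableAt_LFunction _ (Or.inl hne)
  rw [logDeriv_apply (LFunctionTrivChar₁ N), heq.deriv_eq, heq.self_of_nhds, ← logDeriv_apply
    (fun s ↦ (s - 1) * (1 : DirichletCharacter ℂ N).LFunction s), logDeriv_mul (f := fun s ↦ s - 1)
      _ (by simpa using ht0) hL0 (by fun_prop) hLd]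
  have : logDeriv (fun z : ℂ ↦ z - 1) (1 + t) = 1 / t := by simp [logDeriv_apply]
  rw [this]
  field_simp
  ring

end DirichletCharacter

namespace DirichletCharacter

variable {ι : Type*} {S : Finset ι} {N : ι → ℕ} [∀ i, NeZero (N i)]
  {ψ : ∀ i, DirichletCharacter ℂ (N i)} {c : ι → ℂ} {F : ℂ → ℂ}

lemma sum_logDeriv_LFunction_eq_of_one_lt_re
    (h : ∀ s : ℂ, 1 < s.re → ∑ i ∈ S, c i * primeLogSum (fun n ↦ ψ i n) s = -deriv F s)
    {s : ℂ} (hs : 1 < s.re) :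
    ∑ i ∈ S, c i * logDeriv (ψ i).LFunction s =
      deriv F s - ∑ i ∈ S, c i * primeLogTail 2 (fun n ↦ ψ i n) s := by
  have : deriv F s = -∑ i ∈ S, c i * primeLogSum (fun n ↦ ψ i n) s := by rw [h s hs, neg_neg]
  rw [this, ← Finset.sum_neg_distrib, ← Finset.sum_sub_distrib]
  refine Finset.sum_congr rfl fun i _ ↦ ?_
  rw [(ψ i).logDeriv_LFunction_eq hs, primeLogTail_one (fun n ↦ (ψ i).norm_le_one _) hs]
  ring

lemma analyticAt_deriv_of_re_pos (hF : ∀ s : ℂ, 0 < s.re → DifferentiableAt ℂ F s) {s : ℂ}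
    (hs : 0 < s.re) : AnalyticAt ℂ (deriv F) s := by
  have hU : IsOpen {w : ℂ | 0 < w.re} := isOpen_lt continuous_const Complex.continuous_re
  have : DifferentiableOn ℂ F {w : ℂ | 0 < w.re} := fun w hw ↦
    (hF w hw).differentiableWithinAt
  exact (this.analyticAt (hU.mem_nhds hs)).deriv

lemma sum_logDeriv_LFunction_eq (hψ : ∀ i ∈ S, ψ i ≠ 1)
    (hF : ∀ s : ℂ, 0 < s.re → DifferentiableAt ℂ F s)
    (h : ∀ s : ℂ, 1 < s.re → ∑ i ∈ S, c i * primeLogSum (fun n ↦ ψ i n) s = -deriv F s)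
    {s : ℂ} (hs : 1 / 2 < s.re) (hs0 : ∀ i ∈ S, (ψ i).LFunction s ≠ 0) :
    ∑ i ∈ S, c i * logDeriv (ψ i).LFunction s =
      deriv F s - ∑ i ∈ S, c i * primeLogTail 2 (fun n ↦ ψ i n) s := by
  classical
  set U : Set ℂ := {w : ℂ | 1 / 2 < w.re} with hUdef
  have hU : IsOpen U := isOpen_lt continuous_const Complex.continuous_re
  set P : ℂ → ℂ := fun w ↦ ∏ i ∈ S, (ψ i).LFunction w with hP
  set f : ℂ → ℂ := fun w ↦
    ∑ i ∈ S, c i * (deriv (ψ i).LFunction w * ∏ j ∈ S.erase i, (ψ j).LFunction w) with hf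
  set g : ℂ → ℂ := fun w ↦
    (deriv F w - ∑ i ∈ S, c i * primeLogTail 2 (fun n ↦ ψ i n) w) * P w with hg
  have hL : ∀ i ∈ S, ∀ w, AnalyticAt ℂ (ψ i).LFunction w := fun i hi w ↦
    (differentiable_LFunction (hψ i hi)).analyticAt w
  have hfP : ∀ w, (∀ i ∈ S, (ψ i).LFunction w ≠ 0) →
      f w = (∑ i ∈ S, c i * logDeriv (ψ i).LFunction w) * P w := by
    intro w hw
    rw [hf, Finset.sum_mul]
    refine Finset.sum_congr rfl fun i hi ↦ ?_
    have := hw i hi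
    simp only [hP]
    rw [← Finset.mul_prod_erase S _ hi, logDeriv_apply]
    field_simp
  have hPan : AnalyticOnNhd ℂ P U := fun w _ ↦
    Finset.analyticAt_fun_prod _ fun i hi ↦ hL i hi w
  have hfan : AnalyticOnNhd ℂ f U := fun w _ ↦
    Finset.analyticAt_fun_sum _ fun i hi ↦ analyticAt_const.mul ((hL i hi w).deriv.mul
      (Finset.analyticAt_fun_prod _ fun j hj ↦ hL j (Finset.mem_of_mem_erase hj) w))
  have hTan : ∀ i, AnalyticOnNhd ℂ (primeLogTail 2 (fun n ↦ ψ i n)) U := by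
    intro i
    refine DifferentiableOn.analyticOnNhd (fun w hw ↦ ?_) hU
    have hw' : 1 / 2 < w.re := hw
    exact (differentiableAt_primeLogTail (fun n ↦ (ψ i).norm_le_one _) (by linarith)
      (by push_cast; linarith)).differentiableWithinAt
  have hgan : AnalyticOnNhd ℂ g U := fun w hw ↦ by
    have hw' : 1 / 2 < w.re := hw
    exact ((analyticAt_deriv_of_re_pos hF (by linarith)).sub
      (Finset.analyticAt_fun_sum _ fun i _ ↦ analyticAt_const.mul (hTan i w hw))).mul (hPan w hw)
  have hconv : IsPreconnected U := (convex_halfSpace_re_gt _).isPreconnected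
  have heq : f =ᶠ[𝓝 2] g := by
    have hV : IsOpen {w : ℂ | 1 < w.re} := isOpen_lt continuous_const Complex.continuous_re
    filter_upwards [hV.mem_nhds (show (1 : ℝ) < (2 : ℂ).re by norm_num)] with w hw
    have hw' : 1 < w.re := hw
    rw [hfP w fun i hi ↦ (ψ i).LFunction_ne_zero_of_one_le_re (Or.inl (hψ i hi)) hw'.le,
      sum_logDeriv_LFunction_eq_of_one_lt_re h hw', hg]
  have := hfan.eqOn_of_preconnected_of_eventuallyEq hgan hconv
    (show (1 / 2 : ℝ) < (2 : ℂ).re by norm_num) heq hs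
  rw [hfP s hs0, hg] at this
  exact mul_right_cancel₀ (Finset.prod_ne_zero_iff.mpr hs0) this

lemma LFunction_two_ne_zero {n : ℕ} [NeZero n] (χ : DirichletCharacter ℂ n) :
    χ.LFunction 2 ≠ 0 :=
  χ.LFunction_ne_zero_of_one_le_re (Or.inr (by norm_num)) (by norm_num)

lemma sum_mul_analyticOrderNatAt_eq_zero (hψ : ∀ i ∈ S, ψ i ≠ 1)
    (hF : ∀ s : ℂ, 0 < s.re → DifferentiableAt ℂ F s)
    (h : ∀ s : ℂ, 1 < s.re → ∑ i ∈ S, c i * primeLogSum (fun n ↦ ψ i n) s = -deriv F s)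
    {ρ : ℂ} (hρ : 1 / 2 ≤ ρ.re) (hρ2 : ρ ≠ 1 / 2) :
    ∑ i ∈ S, c i * analyticOrderNatAt (ψ i).completedLFunction ρ = 0 := by
  have hρ0 : 0 < ρ.re := by linarith
  have h1 : Tendsto (fun t : ℝ ↦ ∑ i ∈ S, c i * ((t : ℂ) * logDeriv (ψ i).LFunction (ρ + t)))
      (𝓝[>] 0) (𝓝 (∑ i ∈ S, c i * analyticOrderNatAt (ψ i).completedLFunction ρ)) := by
    refine tendsto_finsetSum _ fun i hi ↦ ?_
    rw [(ψ i).analyticOrderNatAt_completedLFunction (hψ i hi) hρ0]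
    exact (tendsto_mul_logDeriv (differentiable_LFunction (hψ i hi))
      (ψ i).LFunction_two_ne_zero ρ).const_mul _
  have h2 : Tendsto (fun t : ℝ ↦ (t : ℂ) * deriv F (ρ + t) -
      ∑ i ∈ S, c i * ((t : ℂ) * primeLogTail 2 (fun n ↦ ψ i n) (ρ + t))) (𝓝[>] 0) (𝓝 0) := by
    have h3 := (analyticAt_deriv_of_re_pos hF hρ0).continuousAt.tendsto_ofReal_mul_nhdsGT
    have h4 := tendsto_finsetSum S fun i _ ↦
      ((ψ i).tendsto_mul_primeLogTail_two hρ hρ2).const_mul (c i)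
    simpa using h3.sub h4
  refine tendsto_nhds_unique (h1.congr' ?_) h2
  have hne : ∀ᶠ t : ℝ in 𝓝[>] 0, ∀ i ∈ S, (ψ i).LFunction (ρ + t) ≠ 0 := by
    rw [Filter.eventually_all_finset]
    intro i hi
    have hT : Tendsto (fun t : ℝ ↦ ρ + (t : ℂ)) (𝓝[>] 0) (𝓝[≠] ρ) := by
      refine tendsto_nhdsWithin_iff.mpr ⟨tendsto_add_ofReal_nhdsGT ρ, ?_⟩
      filter_upwards [self_mem_nhdsWithin] with t ht
      simpa using (Set.mem_Ioi.mp ht).ne'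
    exact hT.eventually (eventually_ne_zero_of_entire (differentiable_LFunction (hψ i hi))
      (ψ i).LFunction_two_ne_zero ρ)
  filter_upwards [hne, self_mem_nhdsWithin] with t ht ht0
  have hre : 1 / 2 < (ρ + t : ℂ).re := by
    have : 0 < t := ht0
    simp at hρ ⊢; linarith
  have := sum_logDeriv_LFunction_eq hψ hF h hre ht
  simp_rw [mul_left_comm (c _), ← Finset.mul_sum, ← mul_sub]
  rw [this]

lemma coeff_eq_zero_of_eq_one {i₀ : ι} (hi₀ : i₀ ∈ S) (hψ₀ : ψ i₀ = 1)
    (hψ : ∀ i ∈ S, i ≠ i₀ → ψ i ≠ 1)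
    (hF : ∀ s : ℂ, 0 < s.re → DifferentiableAt ℂ F s)
    (h : ∀ s : ℂ, 1 < s.re → ∑ i ∈ S, c i * primeLogSum (fun n ↦ ψ i n) s = -deriv F s) :
    c i₀ = 0 := by
  classical
  have h1 : Tendsto (fun t : ℝ ↦ ∑ i ∈ S, c i * ((t : ℂ) * logDeriv (ψ i).LFunction (1 + t)))
      (𝓝[>] 0) (𝓝 (∑ i ∈ S, if i = i₀ then -c i₀ else 0)) := by
    refine tendsto_finsetSum _ fun i hi ↦ ?_
    split_ifs with hii
    · subst hii
      rw [hψ₀]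
      simpa using (tendsto_mul_logDeriv_LFunction_one (N := N i)).const_mul (c i)
    · simpa using ((ψ i).continuousAt_logDeriv_LFunction (s := 1) (by simp)
        (Or.inl (hψ i hi hii))).tendsto_ofReal_mul_nhdsGT.const_mul (c i)
  have h2 : Tendsto (fun t : ℝ ↦ (t : ℂ) * deriv F (1 + t) -
      ∑ i ∈ S, c i * ((t : ℂ) * primeLogTail 2 (fun n ↦ ψ i n) (1 + t))) (𝓝[>] 0) (𝓝 0) := by
    have h3 := (analyticAt_deriv_of_re_pos hF
      (show 0 < (1 : ℂ).re by simp)).continuousAt.tendsto_ofReal_mul_nhdsGT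
    have h4 := tendsto_finsetSum S fun i _ ↦ ((ψ i).tendsto_mul_primeLogTail_two (ρ := 1)
      (by norm_num) (by norm_num)).const_mul (c i)
    simpa using h3.sub h4
  have h0 := tendsto_nhds_unique (h1.congr' ?_) h2
  · simpa [hi₀] using h0
  filter_upwards [self_mem_nhdsWithin] with t ht0
  have hre : 1 < (1 + t : ℂ).re := by
    have : 0 < t := ht0
    simpa using this
  have := sum_logDeriv_LFunction_eq_of_one_lt_re h hre
  simp_rw [mul_left_comm (c _), ← Finset.mul_sum, ← mul_sub]
  rw [this]

end DirichletCharacter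

lemma Complex.Gammaℝ_conj (s : ℂ) : Gammaℝ (conj s) = conj (Gammaℝ s) := by
  have h : (Real.pi : ℂ).arg ≠ Real.pi := by
    rw [Complex.arg_ofReal_of_nonneg Real.pi_pos.le]; exact Real.pi_pos.ne
  rw [Gammaℝ_def, Gammaℝ_def, map_mul, ← Gamma_conj]
  congr 1
  · rw [show -conj s / 2 = conj (-s / 2) by simp [map_ofNat], Complex.cpow_conj _ _ h,
      Complex.conj_ofReal]
  · simp [map_ofNat]

lemma differentiable_conj_comp_conj {f : ℂ → ℂ} (hf : Differentiable ℂ f) :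
    Differentiable ℂ fun s ↦ conj (f (conj s)) := fun s ↦ by
  have := (hf (conj s)).conj_conj
  rw [Complex.conj_conj] at this
  exact this

namespace DirichletCharacter

variable {N : ℕ} (χ : DirichletCharacter ℂ N)

lemma gammaFactor_inv_eq_conj (s : ℂ) : χ⁻¹.gammaFactor s = conj (χ.gammaFactor (conj s)) := by
  have hev : χ⁻¹.Even ↔ χ.Even := by
    rw [Even, Even, ← MulChar.star_apply', star_eq_iff_star_eq, star_one, eq_comm]
  by_cases h : χ.Even
  · rw [h.gammaFactor_def, (hev.mpr h).gammaFactor_def, Complex.Gammaℝ_conj, Complex.conj_conj]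
  · have h1 := χ.even_or_odd.resolve_left h
    have h2 := χ⁻¹.even_or_odd.resolve_left (hev.not.mpr h)
    rw [h1.gammaFactor_def, h2.gammaFactor_def, show conj s + 1 = conj (s + 1) by simp,
      Complex.Gammaℝ_conj, Complex.conj_conj]

variable [NeZero N]

lemma LFunction_inv_eq_conj_of_one_lt_re {s : ℂ} (hs : 1 < s.re) :
    χ⁻¹.LFunction s = conj (χ.LFunction (conj s)) := by
  rw [χ⁻¹.LFunction_eq_LSeries hs, χ.LFunction_eq_LSeries (by simpa using hs), LSeries, LSeries,
    Complex.conj_tsum]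
  refine tsum_congr fun n ↦ ?_
  rcases eq_or_ne n 0 with rfl | hn
  · simp
  · have h : (n : ℂ).arg ≠ Real.pi := by rw [Complex.natCast_arg]; exact Real.pi_pos.ne
    rw [LSeries.term_of_ne_zero hn, LSeries.term_of_ne_zero hn, map_div₀, ← MulChar.star_apply',
      Complex.cpow_conj _ _ h, Complex.conj_conj, Complex.conj_natCast]
    rfl

variable {χ}

lemma completedLFunction_inv_eq_conj (hχ : χ ≠ 1) (s : ℂ) :
    χ⁻¹.completedLFunction s = conj (χ.completedLFunction (conj s)) := by
  have h1 : Differentiable ℂ χ⁻¹.completedLFunction :=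
    differentiable_completedLFunction (inv_ne_one.mpr hχ)
  have h2 := differentiable_conj_comp_conj (differentiable_completedLFunction hχ)
  have hV : IsOpen {w : ℂ | 1 < w.re} := isOpen_lt continuous_const Complex.continuous_re
  have heq : χ⁻¹.completedLFunction =ᶠ[𝓝 2] fun s ↦ conj (χ.completedLFunction (conj s)) := by
    filter_upwards [hV.mem_nhds (show (1 : ℝ) < (2 : ℂ).re by norm_num)] with w hw
    have hw' : 1 < w.re := hw
    have hw0 : 0 < w.re := by linarith
    rw [χ⁻¹.completedLFunction_eq_mul hw0, χ.completedLFunction_eq_mul (by simpa using hw0),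
      map_mul, χ.LFunction_inv_eq_conj_of_one_lt_re hw', χ.gammaFactor_inv_eq_conj]
  exact congrFun (AnalyticOnNhd.eq_of_eventuallyEq (fun z _ ↦ h1.analyticAt z)
    (fun z _ ↦ h2.analyticAt z) heq) s

lemma completedLFunction_two_ne_zero (χ : DirichletCharacter ℂ N) :
    χ.completedLFunction 2 ≠ 0 := by
  rw [χ.completedLFunction_eq_mul (by norm_num)]
  exact mul_ne_zero (χ.LFunction_ne_zero_of_one_le_re (Or.inr (by norm_num)) (by norm_num))
    (χ.gammaFactor_ne_zero (by norm_num))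

lemma IsPrimitive.completedLFunction_eq (h : χ.IsPrimitive) (hχ : χ ≠ 1) (s : ℂ) :
    χ.completedLFunction s =
      N ^ (1 / 2 - s) * χ.rootNumber * conj (χ.completedLFunction (1 - conj s)) := by
  have := h.completedLFunction_one_sub (1 - s)
  rw [sub_sub_cancel, completedLFunction_inv_eq_conj hχ, map_sub, map_one] at this
  rw [this]
  ring_nf

/-- The zeros of a primitive completed `L`-function are symmetric about the critical line. -/
lemma IsPrimitive.analyticOrderNatAt_one_sub_conj (h : χ.IsPrimitive) (hχ : χ ≠ 1) (ρ : ℂ) :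
    analyticOrderNatAt χ.completedLFunction ρ =
      analyticOrderNatAt χ.completedLFunction (1 - conj ρ) := by
  have hd := differentiable_completedLFunction hχ
  obtain ⟨g, hg, hg0, hfg⟩ := exists_entire_factor hd
    (analyticOrderAt_ne_top_of_entire hd χ.completedLFunction_two_ne_zero (1 - conj ρ))
  set m := analyticOrderNatAt χ.completedLFunction (1 - conj ρ)
  have hN : (N : ℂ) ≠ 0 := by exact_mod_cast NeZero.ne N
  have hW : χ.rootNumber ≠ 0 := by
    intro h0
    have := h.completedLFunction_eq hχ 2
    rw [h0] at this
    exact χ.completedLFunction_two_ne_zero (by simpa using this)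
  set G : ℂ → ℂ := fun s ↦
    N ^ (1 / 2 - s) * χ.rootNumber * (-1) ^ m * conj (g (1 - conj s)) with hG
  have hGd : Differentiable ℂ G := by
    have h1 : Differentiable ℂ fun s : ℂ ↦ (N : ℂ) ^ (1 / 2 - s) := fun s ↦
      (differentiableAt_id.const_sub _).const_cpow (Or.inl hN)
    have h2 : Differentiable ℂ fun s ↦ conj (g (1 - conj s)) :=
      differentiable_conj_comp_conj (f := fun s ↦ g (1 - s)) (hg.comp (by fun_prop))
    exact ((h1.mul_const _).mul_const _).mul h2
  have hord : analyticOrderAt χ.completedLFunction ρ = m := by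
    refine (hd.analyticAt ρ).analyticOrderAt_eq_natCast.mpr ⟨G, hGd.analyticAt ρ, ?_,
      Eventually.of_forall fun s ↦ ?_⟩
    · refine mul_ne_zero (mul_ne_zero (mul_ne_zero ?_ hW) (by simp)) (by simpa using hg0)
      exact Complex.cpow_ne_zero_iff.mpr (Or.inl hN)
    · rw [h.completedLFunction_eq hχ s, hfg, hG, map_mul, map_pow, smul_eq_mul]
      have : conj (1 - conj s - (1 - conj ρ)) = -1 * (s - ρ) := by
        simp only [map_sub, map_one, Complex.conj_conj]; ring
      rw [this, mul_pow]
      ring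
  rw [analyticOrderNatAt, hord, ENat.toNat_natCast]

end DirichletCharacter

lemma Complex.norm_Gamma_le {s : ℂ} (hs : 0 < s.re) : ‖Gamma s‖ ≤ Real.Gamma s.re := by
  rw [Complex.Gamma_eq_integral hs, Real.Gamma_eq_integral hs, Complex.GammaIntegral]
  refine (MeasureTheory.norm_integral_le_integral_norm _).trans_eq ?_
  refine MeasureTheory.setIntegral_congr_fun measurableSet_Ioi fun x hx ↦ ?_
  have hx' : 0 < x := hx
  simp only [norm_mul, Complex.norm_real, Complex.norm_cpow_eq_rpow_re_of_pos hx', Real.norm_eq_abs,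
    Real.abs_exp, Complex.sub_re, Complex.one_re]

lemma Real.Gamma_le_exp_sq {x : ℝ} (hx : 1 / 4 ≤ x) :
    Real.Gamma x ≤ 16 * Real.exp ((x + 2) ^ 2) := by
  have hx0 : 0 < x := by linarith
  set m := ⌈x⌉₊ + 1 with hm
  have hmx : (m : ℝ) ≤ x + 2 := by
    have := Nat.ceil_lt_add_one hx0.le
    push_cast [hm]; linarith
  have hxm : x + 2 ≤ m + 1 := by
    have := Nat.le_ceil x
    push_cast [hm]; linarith
  have h1 : Real.Gamma (x + 2) = (x + 1) * (x * Real.Gamma x) := by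
    rw [← Real.Gamma_add_one hx0.ne', ← Real.Gamma_add_one (by linarith)]
    congr 1; ring
  have h2 : Real.Gamma (x + 2) ≤ Real.Gamma (m + 1) :=
    Real.Gamma_strictMonoOn_Ici.monotoneOn (Set.mem_Ici.mpr (by linarith))
      (Set.mem_Ici.mpr (by linarith)) hxm
  have h3 : (m.factorial : ℝ) ≤ Real.exp ((x + 2) ^ 2) := calc
    (m.factorial : ℝ) ≤ (m : ℝ) ^ m := by exact_mod_cast m.factorial_le_pow
    _ ≤ Real.exp m ^ m := by
      gcongr
      linarith [Real.add_one_le_exp (m : ℝ)]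
    _ = Real.exp ((m : ℝ) ^ 2) := by rw [← Real.exp_nat_mul, sq]
    _ ≤ _ := by gcongr
  rw [Real.Gamma_nat_eq_factorial] at h2
  have h4 : 0 < Real.Gamma x := Real.Gamma_pos_of_pos hx0
  have h5 : Real.Gamma x ≤ 16 * Real.Gamma (x + 2) := by
    rw [h1]
    nlinarith [mul_pos h4 hx0]
  linarith

lemma Complex.norm_Gammaℝ_le {s : ℂ} (hs : 1 / 2 ≤ s.re) :
    ‖Gammaℝ s‖ ≤ 16 * Real.exp ((‖s‖ + 2) ^ 2) := by
  have h0 : 0 < (s / 2).re := by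
    rw [show s / 2 = s / ((2 : ℝ) : ℂ) by simp, Complex.div_ofReal_re]; linarith
  have h2 : (s / 2).re = s.re / 2 := by
    rw [show s / 2 = s / ((2 : ℝ) : ℂ) by simp, Complex.div_ofReal_re]
  have hre := Complex.re_le_norm s
  have h1 : ‖(Real.pi : ℂ) ^ (-s / 2)‖ ≤ 1 := by
    rw [Complex.norm_cpow_eq_rpow_re_of_pos Real.pi_pos]
    refine Real.rpow_le_one_of_one_le_of_nonpos (by linarith [Real.pi_gt_three]) ?_
    rw [neg_div, Complex.neg_re]
    linarith
  rw [Gammaℝ_def, norm_mul]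
  calc _ ≤ 1 * ‖Gamma (s / 2)‖ := by gcongr
    _ ≤ Real.Gamma (s / 2).re := by rw [one_mul]; exact Complex.norm_Gamma_le h0
    _ ≤ 16 * Real.exp (((s / 2).re + 2) ^ 2) := Real.Gamma_le_exp_sq (by rw [h2]; linarith)
    _ ≤ _ := by
      gcongr
      linarith

namespace DirichletCharacter

variable {N : ℕ} [NeZero N] {χ : DirichletCharacter ℂ N}

lemma sum_range_eq_zero (hχ : χ ≠ 1) (n : ℕ) :
    ∑ k ∈ Finset.range N, χ ((n + k : ℕ) : ZMod N) = 0 := by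
  rw [← MulChar.sum_eq_zero_of_ne_one hχ]
  refine Finset.sum_nbij' (fun k ↦ ((n + k : ℕ) : ZMod N)) (fun b ↦ (b - n : ZMod N).val)
    (fun _ _ ↦ Finset.mem_univ _) (fun b _ ↦ Finset.mem_range.mpr (ZMod.val_lt _)) ?_ ?_ ?_
  · intro k hk
    push_cast
    rw [add_sub_cancel_left, ZMod.val_cast_of_lt (Finset.mem_range.mp hk)]
  · intro b _
    push_cast
    rw [ZMod.natCast_zmod_val, add_sub_cancel]
  · intro k _
    rfl

lemma norm_sum_range_le (hχ : χ ≠ 1) (n : ℕ) : ‖∑ k ∈ Finset.range n, χ (k : ZMod N)‖ ≤ N := by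
  have hper : ∀ m r : ℕ, ∑ k ∈ Finset.range (N * m + r), χ (k : ZMod N) =
      ∑ k ∈ Finset.range r, χ (k : ZMod N) := by
    intro m r
    induction m with
    | zero => simp
    | succ m ih =>
      rw [show N * (m + 1) + r = N * m + r + N by ring, Finset.sum_range_add, ih,
        sum_range_eq_zero hχ, add_zero]
  rw [← Nat.div_add_mod n N, hper]
  calc _ ≤ ∑ k ∈ Finset.range (n % N), ‖χ (k : ZMod N)‖ := norm_sum_le _ _
    _ ≤ ∑ k ∈ Finset.range (n % N), (1 : ℝ) := Finset.sum_le_sum fun k _ ↦ χ.norm_le_one _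
    _ = (n % N : ℕ) := by simp
    _ ≤ N := by exact_mod_cast (Nat.mod_lt _ (NeZero.pos N)).le

lemma exists_norm_LFunction_le (hχ : χ ≠ 1) :
    ∃ C : ℝ, 0 ≤ C ∧ ∀ s : ℂ, 0 < s.re → ‖χ.LFunction s‖ ≤ C * ‖s‖ / s.re := by
  have hb : ∀ n : ℕ, ‖∑ k ∈ Finset.Icc 1 n, χ (k : ZMod N)‖ ≤ N + 1 := fun n ↦ by
    have h := Finset.sum_range_succ' (fun k : ℕ ↦ χ (k : ZMod N)) n
    have h' : ∑ k ∈ Finset.Icc 1 n, χ (k : ZMod N) =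
        ∑ k ∈ Finset.range n, χ ((k + 1 : ℕ) : ZMod N) := by
      rw [Finset.range_eq_Ico, Finset.sum_Ico_add' (fun k : ℕ ↦ χ (k : ZMod N))]
      rfl
    rw [h', ← sub_eq_of_eq_add h]
    exact (norm_sub_le _ _).trans (add_le_add (norm_sum_range_le hχ _) (χ.norm_le_one _))
  obtain ⟨E, hE, hEb, hEL⟩ := exists_continuation_of_bounded_sums (a := fun n ↦ χ (n : ZMod N))
    (fun n _ ↦ χ.norm_le_one _) hb
  have hO : IsOpen {w : ℂ | 0 < w.re} := isOpen_lt continuous_const Complex.continuous_re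
  have hV : IsOpen {w : ℂ | 1 < w.re} := isOpen_lt continuous_const Complex.continuous_re
  refine ⟨N + 1, by positivity, fun s hs ↦ ?_⟩
  have heq : Set.EqOn χ.LFunction E {w : ℂ | 0 < w.re} := by
    refine AnalyticOnNhd.eqOn_of_preconnected_of_eventuallyEq (z₀ := 2)
      (DifferentiableOn.analyticOnNhd (differentiable_LFunction hχ).differentiableOn hO)
      (DifferentiableOn.analyticOnNhd (fun w hw ↦ (hE w hw).differentiableWithinAt) hO)
      (convex_halfSpace_re_gt 0).isPreconnected (show (0 : ℝ) < (2 : ℂ).re by norm_num) ?_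
    filter_upwards [hV.mem_nhds (show (1 : ℝ) < (2 : ℂ).re by norm_num)] with w hw
    rw [χ.LFunction_eq_LSeries hw, hEL w hw]
  rw [heq hs]
  exact hEb s hs

lemma exists_norm_completedLFunction_le_of_half_le (hχ : χ ≠ 1) :
    ∃ A : ℝ, 0 ≤ A ∧ ∀ s : ℂ, 1 / 2 ≤ s.re →
      ‖χ.completedLFunction s‖ ≤ Real.exp (A * (1 + ‖s‖) ^ 2) := by
  obtain ⟨C, hC, hL⟩ := exists_norm_LFunction_le hχ
  obtain ⟨a, ha, hγ⟩ := χ.exists_gammaFactor_eq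
  have ha0 : 0 ≤ a := by rcases ha with rfl | rfl <;> norm_num
  have ha1 : a ≤ 1 := by rcases ha with rfl | rfl <;> norm_num
  refine ⟨32 * C + 9, by positivity, fun s hs ↦ ?_⟩
  have hs0 : 0 < s.re := by linarith
  have h1 : ‖χ.LFunction s‖ ≤ 2 * C * ‖s‖ := by
    refine (hL s hs0).trans ?_
    rw [div_le_iff₀ hs0]
    nlinarith [mul_nonneg hC (norm_nonneg s)]
  have h2 : ‖χ.gammaFactor s‖ ≤ 16 * Real.exp ((‖s‖ + 3) ^ 2) := by
    rw [hγ]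
    refine (Complex.norm_Gammaℝ_le (by simp; linarith)).trans ?_
    have : ‖s + a‖ ≤ ‖s‖ + 1 := (norm_add_le _ _).trans (by
      rw [Complex.norm_real, Real.norm_of_nonneg ha0]; linarith)
    gcongr 16 * Real.exp (?_ ^ 2)
    linarith
  have h0 := norm_nonneg s
  rw [χ.completedLFunction_eq_mul hs0, norm_mul]
  calc _ ≤ 2 * C * ‖s‖ * (16 * Real.exp ((‖s‖ + 3) ^ 2)) := by gcongr
    _ = 32 * C * ‖s‖ * Real.exp ((‖s‖ + 3) ^ 2) := by ring
    _ ≤ Real.exp (32 * C * (1 + ‖s‖) ^ 2) * Real.exp (9 * (1 + ‖s‖) ^ 2) := by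
      gcongr
      · refine le_trans ?_ ((le_add_of_nonneg_right zero_le_one).trans (Real.add_one_le_exp _))
        gcongr
        nlinarith
      · nlinarith
    _ = _ := by rw [← Real.exp_add]; ring_nf

lemma IsPrimitive.exists_norm_completedLFunction_le (h : χ.IsPrimitive) (hχ : χ ≠ 1) :
    ∃ A : ℝ, ∀ s : ℂ, ‖χ.completedLFunction s‖ ≤ Real.exp (A * (1 + ‖s‖) ^ 2) := by
  obtain ⟨A, hA, hb⟩ := exists_norm_completedLFunction_le_of_half_le hχ
  have hN : (1 : ℝ) ≤ N := by exact_mod_cast NeZero.one_le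
  have hlog := Real.log_nonneg hN
  refine ⟨Real.log N + ‖χ.rootNumber‖ + 4 * A, fun s ↦ ?_⟩
  have h0 := norm_nonneg s
  have h1 : 1 + ‖s‖ ≤ (1 + ‖s‖) ^ 2 := by nlinarith
  have hW := norm_nonneg χ.rootNumber
  rcases le_or_gt (1 / 2) s.re with hs | hs
  · refine (hb s hs).trans ?_
    gcongr
    linarith
  · have h2 := hb (1 - conj s) (by simp; linarith)
    have h3 : ‖1 - conj s‖ ≤ 1 + ‖s‖ := (norm_sub_le _ _).trans (by simp)
    have h4 : ‖(N : ℂ) ^ (1 / 2 - s)‖ ≤ Real.exp (Real.log N * (1 + ‖s‖) ^ 2) := by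
      rw [Complex.norm_natCast_cpow_of_pos (NeZero.pos N), Real.rpow_def_of_pos (by linarith)]
      gcongr
      have h5 := (abs_le.mp (Complex.abs_re_le_norm s)).1
      have : (1 / 2 - s).re = 1 / 2 - s.re := by simp
      linarith
    have h6 : ‖χ.rootNumber‖ ≤ Real.exp (‖χ.rootNumber‖ * (1 + ‖s‖) ^ 2) := by
      refine le_trans ?_ ((le_add_of_nonneg_right zero_le_one).trans (Real.add_one_le_exp _))
      nlinarith
    rw [h.completedLFunction_eq hχ, norm_mul, norm_mul, Complex.norm_conj]
    calc _ ≤ Real.exp (Real.log N * (1 + ‖s‖) ^ 2) * Real.exp (‖χ.rootNumber‖ * (1 + ‖s‖) ^ 2) *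
        Real.exp (4 * A * (1 + ‖s‖) ^ 2) := by
          gcongr
          refine h2.trans ?_
          gcongr Real.exp ?_
          have : (1 + ‖1 - conj s‖) ^ 2 ≤ 4 * (1 + ‖s‖) ^ 2 := by
            nlinarith [norm_nonneg (1 - conj s)]
          nlinarith
      _ = _ := by rw [← Real.exp_add, ← Real.exp_add]; ring_nf

end DirichletCharacter

lemma Filter.EventuallyEq.logDeriv_eq {f g : ℂ → ℂ} {z : ℂ} (h : f =ᶠ[𝓝 z] g) :
    logDeriv f z = logDeriv g z := by
  rw [logDeriv_apply, logDeriv_apply, h.deriv_eq, h.self_of_nhds]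

lemma tendsto_ofReal_cobounded : Tendsto (fun x : ℝ ↦ (x : ℂ)) atTop (Bornology.cobounded ℂ) := by
  rw [← tendsto_norm_atTop_iff_cobounded]
  simpa using tendsto_abs_atTop_atTop

lemma tendsto_ofReal_div_add_const (a : ℂ) :
    Tendsto (fun x : ℝ ↦ (x : ℂ) / (x + a)) atTop (𝓝 1) := by
  have h1 : Tendsto (fun x : ℝ ↦ (x : ℂ) + a) atTop (Bornology.cobounded ℂ) :=
    (tendsto_add_const_cobounded a).comp tendsto_ofReal_cobounded
  have h2 := ((tendsto_inv₀_cobounded.comp h1).const_mul a).const_sub 1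
  rw [mul_zero, sub_zero] at h2
  refine h2.congr' ?_
  filter_upwards [h1.eventually_ne_cobounded 0] with x hx
  simp only [Function.comp_apply]
  field_simp
  ring

lemma Polynomial.eq_zero_of_tendsto_ofReal_mul_eval {Q : Polynomial ℂ} {l : ℂ}
    (h : Tendsto (fun x : ℝ ↦ (x : ℂ) * Q.eval (x : ℂ)) atTop (𝓝 l)) : l = 0 := by
  rcases eq_or_ne Q 0 with rfl | hQ
  · simp only [Polynomial.eval_zero, mul_zero] at h
    exact tendsto_nhds_unique h tendsto_const_nhds
  · have hd : 0 < (X * Q).degree := by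
      rw [degree_mul, degree_X]
      have := zero_le_degree_iff.mpr hQ
      calc (0 : WithBot ℕ) < 1 := by norm_num
        _ = 1 + 0 := by simp
        _ ≤ _ := by gcongr
    have h1 := (X * Q).tendsto_norm_atTop hd
      (tendsto_norm_atTop_iff_cobounded.mpr tendsto_ofReal_cobounded)
    simp only [eval_mul, eval_X] at h1
    exact absurd h.norm (not_tendsto_nhds_of_tendsto_atTop h1 _)

lemma tendsto_mul_primeLogTail_one_atTop {ψ : ℕ → ℂ} (hψ : ∀ n, ‖ψ n‖ ≤ 1) :
    Tendsto (fun x : ℝ ↦ (x : ℂ) * primeLogTail 1 ψ x) atTop (𝓝 0) := by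
  have hs := summable_log_mul_rpow_primes (a := 2) (by norm_num)
  set K := ∑' p : Nat.Primes, Real.log p * (p : ℝ) ^ (-2 : ℝ) with hK
  have hlim := (tendsto_rpow_mul_exp_neg_mul_atTop_nhds_zero 1 (Real.log 2)
    (Real.log_pos one_lt_two)).const_mul (8 * K)
  rw [mul_zero] at hlim
  refine squeeze_zero_norm' ?_ hlim
  filter_upwards [eventually_ge_atTop 2] with x hx
  have hx0 : 0 < x := by linarith
  have h2 : (2 : ℝ) ^ (-x) = Real.exp (-Real.log 2 * x) := by
    rw [Real.rpow_def_of_pos two_pos]; ring_nf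
  have h3 : (1 - (2 : ℝ) ^ (-x))⁻¹ ≤ 2 := by
    have : (2 : ℝ) ^ (-x) ≤ 2 ^ (-1 : ℝ) :=
      Real.rpow_le_rpow_of_exponent_le one_le_two (by linarith)
    rw [Real.rpow_neg_one] at this
    rw [inv_le_comm₀ (by linarith) two_pos]
    linarith
  have hle : ∀ p : Nat.Primes,
      ‖Real.log p * ((ψ p * (p : ℂ) ^ (-(x : ℂ))) ^ 1 / (1 - ψ p * (p : ℂ) ^ (-(x : ℂ))))‖ ≤
        Real.log p * (p : ℝ) ^ (-2 : ℝ) * (8 * Real.exp (-Real.log 2 * x)) := by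
    intro p
    have hlog : 0 ≤ Real.log p := Real.log_nonneg (by exact_mod_cast p.2.one_le)
    have hp : (0 : ℝ) < p := by exact_mod_cast p.2.pos
    have h4 := prime_rpow_neg_le p (σ := x - 2) (by linarith)
    have h5 : (2 : ℝ) ^ (-(x - 2)) = 4 * Real.exp (-Real.log 2 * x) := by
      rw [neg_sub, sub_eq_add_neg, Real.rpow_add two_pos, h2]
      norm_num
    refine (norm_primeLogTail_term_le hψ 1 p hx0 (Complex.ofReal_re x).ge).trans ?_
    rw [show -(((1 : ℕ) : ℝ) * x) = -2 + -(x - 2) by push_cast; ring, Real.rpow_add hp]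
    have h7 : (2 : ℝ) ^ (-x) < 1 :=
      Real.rpow_lt_one_of_one_lt_of_neg one_lt_two (by linarith)
    calc _ ≤ Real.log p * ((p : ℝ) ^ (-2 : ℝ) * 2 ^ (-(x - 2))) * 2 := by
          gcongr
      _ = _ := by rw [h5]; ring
  have h6 := tsum_of_norm_bounded (hs.mul_right (8 * Real.exp (-Real.log 2 * x))).hasSum hle
  rw [tsum_mul_right] at h6
  rw [norm_mul, Complex.norm_real, Real.norm_of_nonneg hx0.le, Real.rpow_one, primeLogTail]
  calc _ ≤ x * (K * (8 * Real.exp (-Real.log 2 * x))) := by gcongr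
    _ = _ := by ring

namespace DirichletCharacter

section

variable {N : ℕ} (χ : DirichletCharacter ℂ N)

lemma exists_logDeriv_gammaFactor_add_two : ∃ a : ℂ, ∀ s : ℂ, 0 < s.re →
    logDeriv χ.gammaFactor (s + 2) = logDeriv χ.gammaFactor s + 1 / (s + a) := by
  obtain ⟨a, ha, hγ⟩ := χ.exists_gammaFactor_eq
  have ha0 : 0 ≤ a := by rcases ha with rfl | rfl <;> norm_num
  refine ⟨a, fun s hs ↦ ?_⟩
  have hne : ∀ w : ℂ, 0 < w.re → w + a ≠ 0 := fun w hw h ↦ by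
    have := congrArg Complex.re h
    simp at this
    linarith
  have hO : IsOpen {w : ℂ | 0 < w.re} := isOpen_lt continuous_const Complex.continuous_re
  have h : (fun w ↦ χ.gammaFactor (w + 2)) =ᶠ[𝓝 s]
      fun w ↦ χ.gammaFactor w * ((w + a) * (1 / 2 / Real.pi)) := by
    filter_upwards [hO.mem_nhds hs] with w hw
    rw [hγ, hγ, show w + 2 + a = w + a + 2 by ring, Complex.Gammaℝ_add_two (hne w hw)]
    ring
  have h1 : logDeriv (fun w ↦ χ.gammaFactor (w + 2)) s = logDeriv χ.gammaFactor (s + 2) := by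
    rw [logDeriv_apply, logDeriv_apply, deriv_comp_add_const]
  have hpi : (1 / 2 / Real.pi : ℂ) ≠ 0 := by
    simp [Real.pi_ne_zero]
  rw [← h1, Filter.EventuallyEq.logDeriv_eq h,
    logDeriv_mul (g := fun w : ℂ ↦ (w + a) * (1 / 2 / Real.pi)) s
    (χ.gammaFactor_ne_zero hs) (mul_ne_zero (hne s hs) hpi)
    (χ.differentiableAt_gammaFactor hs) (by fun_prop), logDeriv_mul_const s _ hpi]
  congr 1
  rw [logDeriv_apply, deriv_add_const, deriv_id'']

variable [NeZero N]

lemma tendsto_mul_logDeriv_LFunction_atTop :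
    Tendsto (fun x : ℝ ↦ (x : ℂ) * logDeriv χ.LFunction x) atTop (𝓝 0) := by
  have := (tendsto_mul_primeLogTail_one_atTop (ψ := fun n ↦ χ n) fun n ↦ χ.norm_le_one _).neg
  rw [neg_zero] at this
  refine this.congr' ?_
  filter_upwards [eventually_gt_atTop 1] with x hx
  rw [χ.logDeriv_LFunction_eq (by simpa using hx), mul_neg]

lemma tendsto_mul_logDeriv_LFunction_add_two_atTop :
    Tendsto (fun x : ℝ ↦ (x : ℂ) * logDeriv χ.LFunction (x + 2)) atTop (𝓝 0) := by
  have h1 := χ.tendsto_mul_logDeriv_LFunction_atTop.comp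
    (tendsto_atTop_add_const_right atTop 2 tendsto_id)
  have h2 := (tendsto_ofReal_div_add_const 2).mul h1
  rw [mul_zero] at h2
  refine h2.congr' ?_
  filter_upwards [eventually_gt_atTop 1] with x hx
  have : (x : ℂ) + 2 ≠ 0 := by norm_cast; positivity
  simp only [Function.comp_apply, id]
  push_cast
  field_simp

lemma logDeriv_completedLFunction_eq {s : ℂ} (hs : 1 < s.re) :
    logDeriv χ.completedLFunction s = logDeriv χ.LFunction s + logDeriv χ.gammaFactor s := by
  have hO : IsOpen {w : ℂ | 0 < w.re} := isOpen_lt continuous_const Complex.continuous_re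
  have hs0 : 0 < s.re := by linarith
  have hs1 : s ≠ 1 := by rintro rfl; simp at hs
  have h : χ.completedLFunction =ᶠ[𝓝 s] fun w ↦ χ.LFunction w * χ.gammaFactor w := by
    filter_upwards [hO.mem_nhds hs0] with w hw
    exact χ.completedLFunction_eq_mul hw
  rw [Filter.EventuallyEq.logDeriv_eq h,
    logDeriv_mul s (χ.LFunction_ne_zero_of_one_le_re (Or.inr hs1) hs.le)
    (χ.gammaFactor_ne_zero hs0) (χ.differentiableAt_LFunction _ (Or.inl hs1))
    (χ.differentiableAt_gammaFactor hs0)]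

end

variable {ι : Type*} {S : Finset ι} {N : ι → ℕ} [∀ i, NeZero (N i)]
  {ψ : ∀ i, DirichletCharacter ℂ (N i)} {c : ι → ℂ} {F : ℂ → ℂ}

/-- Coefficients of primitive nontrivial characters sum to zero as soon as the corresponding prime
sums continue holomorphically to the right half-plane. -/
theorem sum_coeff_eq_zero (hprim : ∀ i ∈ S, (ψ i).IsPrimitive) (hψ : ∀ i ∈ S, ψ i ≠ 1)
    (hF : ∀ s : ℂ, 0 < s.re → DifferentiableAt ℂ F s)
    (h : ∀ s : ℂ, 1 < s.re → ∑ i ∈ S, c i * primeLogSum (fun n ↦ ψ i n) s = -deriv F s) :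
    ∑ i ∈ S, c i = 0 := by
  have hz : ∀ ρ : ℂ, ρ ≠ 1 / 2 →
      ∑ i ∈ S, c i * analyticOrderNatAt (ψ i).completedLFunction ρ = 0 := by
    intro ρ hρ
    rcases le_or_gt (1 / 2) ρ.re with hre | hre
    · exact sum_mul_analyticOrderNatAt_eq_zero hψ hF h hre hρ
    · rw [Finset.sum_congr rfl fun i hi ↦ by
        rw [(hprim i hi).analyticOrderNatAt_one_sub_conj (hψ i hi)]]
      refine sum_mul_analyticOrderNatAt_eq_zero hψ hF h (by simp; linarith) fun h1 ↦ ?_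
      have := congrArg Complex.re h1
      norm_num at this
      linarith
  obtain ⟨μ, P, hP⟩ := exists_sum_logDeriv_eq_polynomial S (a := c) (c := 2)
    (fun i hi ↦ differentiable_completedLFunction (hψ i hi))
    (fun i _ ↦ (ψ i).completedLFunction_two_ne_zero)
    (fun i hi ↦ (hprim i hi).exists_norm_completedLFunction_le (hψ i hi)) hz
  choose a ha using fun i ↦ (ψ i).exists_logDeriv_gammaFactor_add_two
  have hne : ∀ x : ℝ, 1 < x → ∀ i, (ψ i).completedLFunction x ≠ 0 := fun x hx i ↦ by
    rw [(ψ i).completedLFunction_eq_mul (by simp; linarith)]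
    exact mul_ne_zero ((ψ i).LFunction_ne_zero_of_one_le_re
      (Or.inr (by exact_mod_cast hx.ne')) (by simpa using hx.le))
      ((ψ i).gammaFactor_ne_zero (by simp; linarith))
  have hlim : Tendsto (fun x : ℝ ↦ ∑ i ∈ S, c i * ((x : ℂ) * logDeriv (ψ i).LFunction (x + 2) -
      x * logDeriv (ψ i).LFunction x + x / (x + a i)) -
      μ * (x / (x + 3 / 2) - x / (x + -(1 / 2)))) atTop
      (𝓝 (∑ i ∈ S, c i * (0 - 0 + 1) - μ * (1 - 1))) :=
    (tendsto_finsetSum _ fun i _ ↦ (((ψ i).tendsto_mul_logDeriv_LFunction_add_two_atTop.sub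
      (ψ i).tendsto_mul_logDeriv_LFunction_atTop).add
        (tendsto_ofReal_div_add_const _)).const_mul _).sub
      (((tendsto_ofReal_div_add_const _).sub (tendsto_ofReal_div_add_const _)).const_mul _)
  simp only [sub_zero, zero_add, mul_one, sub_self, mul_zero] at hlim
  refine Polynomial.eq_zero_of_tendsto_ofReal_mul_eval
    (Q := P.comp (Polynomial.X + Polynomial.C 2) - P) (hlim.congr' ?_)
  filter_upwards [eventually_gt_atTop 1] with x hx
  have hx2 : (1 : ℝ) < x + 2 := by linarith
  have e1 := hP x (fun h0 ↦ by have := congrArg Complex.re h0; norm_num at this; linarith)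
    fun i _ ↦ hne x hx i
  have e2 := hP (x + 2 : ℝ) (fun h0 ↦ by have := congrArg Complex.re h0; norm_num at this; linarith)
    fun i _ ↦ hne _ hx2 i
  push_cast at e2
  have e3 : ∀ i ∈ S, c i * ((x : ℂ) * logDeriv (ψ i).LFunction (x + 2) -
      x * logDeriv (ψ i).LFunction x + x / (x + a i)) =
      x * (c i * logDeriv (ψ i).completedLFunction (x + 2) -
        c i * logDeriv (ψ i).completedLFunction x) := fun i _ ↦ by
    rw [logDeriv_completedLFunction_eq _ (s := x) (by simpa using hx),
      logDeriv_completedLFunction_eq _ (s := x + 2) (by simpa using hx2),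
      ha i x (by simp; linarith)]
    ring
  rw [Finset.sum_congr rfl e3, ← Finset.mul_sum, Finset.sum_sub_distrib, e1, e2]
  simp only [Polynomial.eval_sub, Polynomial.eval_comp, Polynomial.eval_add, Polynomial.eval_X,
    Polynomial.eval_C]
  ring

end DirichletCharacter

lemma DirichletCharacter.exists_sum_mul_eq {q : ℕ} [NeZero q] (g : ZMod q → ℂ) :
    ∃ c : DirichletCharacter ℂ q → ℂ, ∀ b, IsUnit b → ∑ χ, c χ * χ b = g b := by
  refine ⟨fun χ ↦ (q.totient : ℂ)⁻¹ * ∑ x : (ZMod q)ˣ, g x * χ (x : ZMod q)⁻¹, fun b hb ↦ ?_⟩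
  obtain ⟨y, rfl⟩ := hb
  have hφ : (q.totient : ℂ) ≠ 0 := by
    exact_mod_cast (Nat.totient_pos.mpr (NeZero.pos q)).ne'
  calc _ = (q.totient : ℂ)⁻¹ * ∑ x : (ZMod q)ˣ, g x *
        ∑ χ : DirichletCharacter ℂ q, χ (x : ZMod q)⁻¹ * χ y := by
        simp only [Finset.mul_sum, Finset.sum_mul]
        rw [Finset.sum_comm]
        refine Finset.sum_congr rfl fun x _ ↦ Finset.sum_congr rfl fun χ _ ↦ ?_
        ring
    _ = (q.totient : ℂ)⁻¹ * ∑ x : (ZMod q)ˣ, if x = y then g x * q.totient else 0 := by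
        congr 1
        refine Finset.sum_congr rfl fun x _ ↦ ?_
        rw [DirichletCharacter.sum_char_inv_mul_char_eq ℂ x.isUnit]
        simp only [Units.val_inj, mul_ite, mul_zero]
    _ = g y := by
        rw [Finset.sum_ite_eq' Finset.univ y, if_pos (Finset.mem_univ _)]
        field_simp

lemma exists_deriv_eq_neg_primeLogSum {u : ℕ → ℂ} {M C : ℝ} (hM : ∀ n, ‖u n‖ ≤ M)
    (hu : ∀ n, ¬ n.Prime → u n = 0) (hC : ∀ n, ‖∑ k ∈ Finset.range n, u k‖ ≤ C) :
    ∃ F : ℂ → ℂ, (∀ s, 0 < s.re → DifferentiableAt ℂ F s) ∧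
      ∀ s, 1 < s.re → primeLogSum u s = -deriv F s := by
  have hC' : ∀ n, ‖∑ k ∈ Finset.Icc 1 n, u k‖ ≤ C := fun n ↦ by
    have h : ∑ k ∈ Finset.Icc 1 n, u k = ∑ k ∈ Finset.range (n + 1), u k := by
      rw [Finset.sum_range_succ', hu 0 Nat.not_prime_zero, add_zero, Finset.range_eq_Ico,
        Finset.sum_Ico_add' u]
      rfl
    rw [h]
    exact hC _
  obtain ⟨F, hF, -, hFL⟩ := exists_continuation_of_bounded_sums (fun n _ ↦ hM n) hC'
  refine ⟨F, hF, fun s hs ↦ ?_⟩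
  have hV : IsOpen {w : ℂ | 1 < w.re} := isOpen_lt continuous_const Complex.continuous_re
  have h : LSeries u =ᶠ[𝓝 s] F := by
    filter_upwards [hV.mem_nhds hs] with w hw using hFL w hw
  rw [← h.deriv_eq, deriv_LSeries_eq_neg_primeLogSum hM hu hs, neg_neg]

lemma sum_mul_primeLogSum_eq {ι : Type*} {S : Finset ι} {c : ι → ℂ} {ψ : ι → ℕ → ℂ}
    (hψ : ∀ i n, ‖ψ i n‖ ≤ 1) {u : ℕ → ℂ} (hu : ∀ p, p.Prime → u p = ∑ i ∈ S, c i * ψ i p)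
    {s : ℂ} (hs : 1 < s.re) : ∑ i ∈ S, c i * primeLogSum (ψ i) s = primeLogSum u s := by
  simp only [primeLogSum, ← tsum_mul_left]
  rw [← Summable.tsum_finsetSum fun i _ ↦ (summable_primeLogSum (hψ i) hs).mul_left (c i)]
  refine tsum_congr fun p ↦ ?_
  rw [hu p p.2, Finset.sum_mul, Finset.mul_sum]
  refine Finset.sum_congr rfl fun i _ ↦ ?_
  ring

namespace DirichletCharacter

variable {q : ℕ}

instance [NeZero q] (χ : DirichletCharacter ℂ q) : NeZero χ.conductor := ⟨χ.conductor_ne_zero⟩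

lemma primitiveCharacter_apply_natCast (χ : DirichletCharacter ℂ q) {n : ℕ} (hn : n.Coprime q) :
    χ.primitiveCharacter n = χ n := by
  simpa using χ.primitiveCharacter_apply_of_isCoprime (Nat.isCoprime_iff_coprime.mpr hn)

lemma primitiveCharacter_ne_one {χ : DirichletCharacter ℂ q} (hχ : χ ≠ 1) :
    χ.primitiveCharacter ≠ 1 := by
  intro h
  have := χ.changeLevel_primitiveCharacter
  rw [h, changeLevel_one] at this
  exact hχ this.symm

end DirichletCharacter

open Classical in
/-- A function on residues agreeing with the sign of `POdd` at almost all primes vanishes at `1`. -/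
theorem eq_zero_of_eq_sign_POdd {q : ℕ} [NeZero q] {g : ZMod q → ℂ} {T : Set ℕ} (hT : T.Finite)
    (hg : ∀ p : ℕ, p.Prime → p ∉ T → g p = if p ∈ POdd then 1 else -1) : g 1 = 0 := by
  obtain ⟨c, hc⟩ := DirichletCharacter.exists_sum_mul_eq g
  set ψ : ∀ χ : DirichletCharacter ℂ q, DirichletCharacter ℂ χ.conductor :=
    fun χ ↦ χ.primitiveCharacter with hψ
  set u : ℕ → ℂ := fun n ↦ if n.Prime then ∑ χ, c χ * ψ χ n else 0 with hu
  have hu0 : ∀ n, ¬ n.Prime → u n = 0 := fun n hn ↦ if_neg hn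
  have hup : ∀ p, p.Prime → u p = ∑ χ, c χ * ψ χ p := fun p hp ↦ if_pos hp
  have hbound : ∀ n, ‖u n‖ ≤ ∑ χ, ‖c χ‖ := fun n ↦ by
    by_cases hn : n.Prime
    · rw [hup n hn]
      refine (norm_sum_le _ _).trans (Finset.sum_le_sum fun χ _ ↦ ?_)
      rw [norm_mul]
      exact mul_le_of_le_one_right (norm_nonneg _) ((ψ χ).norm_le_one _)
    · rw [hu0 n hn, norm_zero]
      positivity
  obtain ⟨C, hC⟩ := exists_bound_sum_of_eq_sign_POdd (u := u)
    (hT.union (q.primeFactors.finite_toSet)) hu0 fun p hp hpT ↦ by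
      rw [Set.mem_union, not_or] at hpT
      have hpq : p.Coprime q := (Nat.Prime.coprime_iff_not_dvd hp).mpr fun h ↦
        hpT.2 (Finset.mem_coe.mpr (Nat.mem_primeFactors.mpr ⟨hp, h, NeZero.ne q⟩))
      rw [← hg p hp hpT.1, ← hc p ((ZMod.isUnit_iff_coprime p q).mpr hpq), hup p hp]
      exact Finset.sum_congr rfl fun χ _ ↦ by rw [hψ, χ.primitiveCharacter_apply_natCast hpq]
  obtain ⟨F, hF, hFu⟩ := exists_deriv_eq_neg_primeLogSum hbound hu0 hC
  have hsum : ∀ s : ℂ, 1 < s.re →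
      ∑ χ, c χ * primeLogSum (fun n ↦ ψ χ n) s = -deriv F s := fun s hs ↦ by
    rw [← hFu s hs]
    exact sum_mul_primeLogSum_eq (fun χ n ↦ (ψ χ).norm_le_one _) hup hs
  have h1 : c 1 = 0 := DirichletCharacter.coeff_eq_zero_of_eq_one (ψ := ψ) (Finset.mem_univ 1)
    DirichletCharacter.primitiveCharacter_one
    (fun χ _ hχ ↦ DirichletCharacter.primitiveCharacter_ne_one hχ) hF hsum
  have h2 : ∑ χ ∈ Finset.univ.erase 1, c χ = 0 := by
    refine DirichletCharacter.sum_coeff_eq_zero (ψ := ψ)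
      (fun χ _ ↦ χ.primitiveCharacter_isPrimitive)
      (fun χ hχ ↦ DirichletCharacter.primitiveCharacter_ne_one (Finset.ne_of_mem_erase hχ)) hF
      fun s hs ↦ ?_
    rw [← hsum s hs, ← Finset.add_sum_erase _ _ (Finset.mem_univ 1), h1, zero_mul, zero_add]
  rw [← hc 1 isUnit_one]
  simp only [map_one, mul_one]
  rw [← Finset.add_sum_erase _ _ (Finset.mem_univ 1), h1, h2, add_zero]

/-- `P_odd` cannot be realized, even up to finitely many exceptions, as a finite union of
sets of primes in arithmetic progressions. -/
theorem pOdd_not_union_of_progressions :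
    ¬ ∃ (q : ℕ) (_ : 0 < q) (r : ℕ) (a : Fin r → ZMod q),
        (symmDiff POdd (⋃ j, residueClassPrimes q (a j))).Finite := by
  classical
  rintro ⟨q, hq, r, a, hfin⟩
  have : NeZero q := ⟨hq.ne'⟩
  have h := eq_zero_of_eq_sign_POdd (g := fun b ↦ if b ∈ Set.range a then 1 else -1) hfin
    fun p hp hpT ↦ by
      have hmem : p ∈ ⋃ j, residueClassPrimes q (a j) ↔ (p : ZMod q) ∈ Set.range a := by
        simp [residueClassPrimes, hp, eq_comm]
      rw [Set.mem_symmDiff, hmem] at hpT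
      have : p ∈ POdd ↔ (p : ZMod q) ∈ Set.range a := by tauto
      simp only [this]
  split_ifs at h <;> norm_num at h
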